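/- Let A be the Artin group of type D_4 and let (x_0,…,x_5) be a type II 6-cycle with x_0 ∩ x_3 = ∅. Then either there exists a left coset z of A_b̂ with z ∩ x_1 ≠ ∅ and z ∩ x_5 ≠ ∅, or the cycle satisfies property (*): there exists a left coset z of A_â or of A_b̂ with z ∩ x_1 ≠ ∅, z ∩ x_3 ≠ ∅ and z ∩ x_5 ≠ ∅. -/

import Mathlib

/-!
The Artin group of type `D₄`, with generators `a, b, c, d`, where `d` is the central node of
the Dynkin diagram: relations `ada = dad`, `bdb = dbd`, `cdc = dcd`, `ab = ba`, `ac = ca`,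
`bc = cb`.
-/

open Pointwise

namespace D4Artin

/-- The generators of the `D₄` Artin group. -/
inductive Gen : Type
  | a | b | c | d
deriving DecidableEq

open Gen

/-- The defining relators of the `D₄` Artin group: a braid relation `sts = tst` whenever one of
`s, t` is the central node `d`, and commutation `st = ts` otherwise. -/
def Rels : Set (FreeGroup Gen) :=
  { r | ∃ s t : Gen, s ≠ t ∧
      (((s = d ∨ t = d) ∧
          r = FreeGroup.of s * FreeGroup.of t * FreeGroup.of s *
              (FreeGroup.of t * FreeGroup.of s * FreeGroup.of t)⁻¹) ∨
        ((s ≠ d ∧ t ≠ d) ∧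
          r = FreeGroup.of s * FreeGroup.of t * (FreeGroup.of s)⁻¹ * (FreeGroup.of t)⁻¹)) }

/-- The Artin group of type `D₄`. -/
abbrev Artin : Type := PresentedGroup Rels

/-- The generators, as elements of the Artin group. -/
def gen (s : Gen) : Artin := PresentedGroup.of s

/-- The standard parabolic subgroup `A_ŝ` generated by the three generators other than `s`. -/
def Ahat (s : Gen) : Subgroup Artin :=
  Subgroup.closure { x | ∃ t : Gen, t ≠ s ∧ x = gen t }

/-- `X` is a left coset of the subgroup `H`. -/
def IsCosetOf (X : Set Artin) (H : Subgroup Artin) : Prop :=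
  ∃ g : Artin, X = g • (H : Set Artin)

/-- A type II 6-cycle: `x 0, x 4` are distinct left cosets of `A_â`, `x 2` is a left coset of
`A_b̂`, `x 1, x 3, x 5` are pairwise distinct left cosets of `A_ĉ`, and consecutive cosets
(indices mod 6) have nonempty intersection. -/
def TypeII (x : Fin 6 → Set Artin) : Prop :=
  IsCosetOf (x 0) (Ahat a) ∧ IsCosetOf (x 4) (Ahat a) ∧ IsCosetOf (x 2) (Ahat b) ∧
  IsCosetOf (x 1) (Ahat c) ∧ IsCosetOf (x 3) (Ahat c) ∧ IsCosetOf (x 5) (Ahat c) ∧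
  x 0 ≠ x 4 ∧ x 1 ≠ x 3 ∧ x 1 ≠ x 5 ∧ x 3 ≠ x 5 ∧
  ∀ i : Fin 6, (x i ∩ x (i + 1)).Nonempty

/-- Property `(*)` for a 6-cycle: there is a left coset of `A_â` or of `A_b̂` meeting each of
`x 1`, `x 3`, `x 5`. -/
def Star (x : Fin 6 → Set Artin) : Prop :=
  ∃ z : Set Artin, (IsCosetOf z (Ahat a) ∨ IsCosetOf z (Ahat b)) ∧
    (z ∩ x 1).Nonempty ∧ (z ∩ x 3).Nonempty ∧ (z ∩ x 5).Nonempty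

end D4Artin

open D4Artin D4Artin.Gen

namespace D4Artin

/-! ### The universal Coxeter group of rank four and its normal forms -/

/-- The relators `s_j²` of the universal Coxeter group of rank four. -/
def CoxRels : Set (FreeGroup (Fin 4)) :=
  { r | ∃ j, r = FreeGroup.of j * FreeGroup.of j }

/-- The universal Coxeter group of rank four, a free product of four groups of order two. -/
abbrev Cox : Type := PresentedGroup CoxRels

/-- The standard generators of `Cox`. -/
def refl (j : Fin 4) : Cox := PresentedGroup.of j

@[simp]
theorem refl_mul_self (j : Fin 4) : refl j * refl j = 1 :=
  PresentedGroup.one_of_mem (rels := CoxRels) ⟨j, rfl⟩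

@[simp]
theorem refl_mul_cancel (j : Fin 4) (x : Cox) : refl j * (refl j * x) = x := by
  rw [← mul_assoc, refl_mul_self, one_mul]

@[simp]
theorem refl_inv (j : Fin 4) : (refl j)⁻¹ = refl j :=
  inv_eq_of_mul_eq_one_left (refl_mul_self j)

/-- A homomorphism out of `Cox`, given by involutions. -/
def Cox.lift {G : Type*} [Group G] (f : Fin 4 → G) (hf : ∀ j, f j * f j = 1) : Cox →* G :=
  PresentedGroup.toGroup (f := f) (by
    rintro _ ⟨j, rfl⟩
    simpa using hf j)

@[simp]
theorem Cox.lift_refl {G : Type*} [Group G] (f : Fin 4 → G) (hf : ∀ j, f j * f j = 1)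
    (j : Fin 4) : Cox.lift f hf (refl j) = f j :=
  PresentedGroup.toGroup.of _

theorem Cox.hom_ext {G : Type*} [Group G] {f g : Cox →* G} (h : ∀ j, f (refl j) = g (refl j)) :
    f = g :=
  PresentedGroup.ext h

theorem Cox.induction {p : Cox → Prop} (one : p 1) (mul : ∀ j x, p x → p (refl j * x))
    (x : Cox) : p x := by
  have hx : x ∈ Subgroup.closure (Set.range refl) := by
    rw [show Set.range refl = Set.range (PresentedGroup.of (rels := CoxRels)) from rfl,
      PresentedGroup.closure_range_of]
    trivial
  induction hx using Subgroup.closure_induction_left with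
  | one => exact one
  | mul_left y hy z _ ih =>
    obtain ⟨j, rfl⟩ := hy
    exact mul j z ih
  | inv_mul_cancel y hy z _ ih =>
    obtain ⟨j, rfl⟩ := hy
    rw [refl_inv]
    exact mul j z ih

/-- Left multiplication by a letter on reduced words. -/
def toggle (j : Fin 4) : List (Fin 4) → List (Fin 4)
  | [] => [j]
  | l :: w => if l = j then w else j :: l :: w

theorem isChain_toggle (j : Fin 4) {w : List (Fin 4)} (hw : w.IsChain (· ≠ ·)) :
    (toggle j w).IsChain (· ≠ ·) := by
  rcases w with _ | ⟨l, w⟩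
  · simp [toggle]
  · by_cases h : l = j
    · simpa [toggle, h] using hw.tail
    · simpa [toggle, h, Ne.symm h] using hw

theorem toggle_toggle (j : Fin 4) {w : List (Fin 4)} (hw : w.IsChain (· ≠ ·)) :
    toggle j (toggle j w) = w := by
  rcases w with _ | ⟨l, _ | ⟨m, w⟩⟩
  · simp [toggle]
  · by_cases h : l = j <;> simp [toggle, h]
  · by_cases h : l = j
    · subst h
      have : m ≠ l := by
        rw [List.isChain_cons_cons] at hw
        exact hw.1.symm
      simp [toggle, this]
    · simp [toggle, h]

/-- The reduced words. -/
abbrev RedWord : Type := { w : List (Fin 4) // w.IsChain (· ≠ ·) }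

/-- Left multiplication by a letter, as a permutation of the reduced words. -/
def togglePerm (j : Fin 4) : Equiv.Perm RedWord :=
  Function.Involutive.toPerm (fun w => ⟨toggle j w.1, isChain_toggle j w.2⟩)
    (fun w => Subtype.ext (toggle_toggle j w.2))

/-- The action of `Cox` on reduced words. -/
def wordAction : Cox →* Equiv.Perm RedWord :=
  Cox.lift togglePerm (fun j => Equiv.ext (fun w => Subtype.ext (toggle_toggle j w.2)))

/-- The reduced word of an element of `Cox`. -/
def nf (x : Cox) : List (Fin 4) := (wordAction x ⟨[], List.isChain_nil⟩).1

/-- The element of `Cox` represented by a word. -/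
def word (w : List (Fin 4)) : Cox := (w.map refl).prod

@[simp] theorem word_nil : word [] = 1 := rfl

@[simp] theorem word_cons (j : Fin 4) (w : List (Fin 4)) : word (j :: w) = refl j * word w := by
  simp [word]

@[simp] theorem word_append (v w : List (Fin 4)) : word (v ++ w) = word v * word w := by
  simp [word]

theorem word_reverse (w : List (Fin 4)) : word w.reverse = (word w)⁻¹ := by
  induction w with
  | nil => simp
  | cons j w ih => simp [ih]

@[simp] theorem nf_one : nf 1 = [] := by simp [nf]

theorem isChain_nf (x : Cox) : (nf x).IsChain (· ≠ ·) := (wordAction x ⟨[], _⟩).2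

theorem nf_refl_mul (j : Fin 4) (x : Cox) : nf (refl j * x) = toggle j (nf x) := by
  simp only [nf, map_mul, wordAction, Cox.lift_refl, Equiv.Perm.mul_apply]
  rfl

theorem word_toggle (j : Fin 4) (w : List (Fin 4)) : word (toggle j w) = refl j * word w := by
  rcases w with _ | ⟨l, w⟩
  · simp [toggle]
  · by_cases h : l = j <;> simp [toggle, h]

@[simp] theorem word_nf (x : Cox) : word (nf x) = x := by
  induction x using Cox.induction with
  | one => simp
  | mul j x ih => rw [nf_refl_mul, word_toggle, ih]

theorem nf_word {w : List (Fin 4)} (hw : w.IsChain (· ≠ ·)) : nf (word w) = w := by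
  induction w with
  | nil => simp
  | cons j w ih =>
    rw [word_cons, nf_refl_mul, ih hw.tail]
    rcases w with _ | ⟨l, w⟩
    · rfl
    · rw [List.isChain_cons_cons] at hw
      simp [toggle, hw.1.symm]

theorem nf_injective : Function.Injective nf := fun x y h => by
  rw [← word_nf x, ← word_nf y, h]

/-- The first letter of a word, or `4` for the empty word. -/
def headLetter : List (Fin 4) → Fin 5
  | [] => 4
  | l :: _ => l.castSucc

/-- The first letter of the reduced word of an element, or `4` for the identity. -/
def hd (x : Cox) : Fin 5 := headLetter (nf x)

@[simp] theorem hd_one : hd 1 = 4 := by simp [hd, headLetter]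

theorem nf_refl_mul_of_hd_ne {l : Fin 4} {x : Cox} (h : hd x ≠ l.castSucc) :
    nf (refl l * x) = l :: nf x := by
  rw [nf_refl_mul]
  unfold hd at h
  rcases hx : nf x with _ | ⟨m, w⟩
  · rfl
  · rw [hx] at h
    have : m ≠ l := fun e => h (by simp [headLetter, e])
    simp [toggle, this]

theorem hd_refl_mul_of_hd_ne {l : Fin 4} {x : Cox} (h : hd x ≠ l.castSucc) :
    hd (refl l * x) = l.castSucc := by
  simp [hd, nf_refl_mul_of_hd_ne h, headLetter]

theorem nf_cons_of_hd_eq {l : Fin 4} {x : Cox} (h : hd x = l.castSucc) :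
    nf x = l :: nf (refl l * x) ∧ hd (refl l * x) ≠ l.castSucc := by
  have hc := isChain_nf x
  unfold hd at *
  rw [nf_refl_mul]
  rcases hx : nf x with _ | ⟨m, w⟩
  · rw [hx] at h
    revert h
    simp only [headLetter]
    revert l
    decide
  · rw [hx] at h hc
    have : m = l := Fin.castSucc_injective _ h
    subst this
    refine ⟨by simp [toggle], ?_⟩
    rcases w with _ | ⟨k, w⟩
    · simp only [toggle, headLetter, if_true]
      clear h hx hc
      revert m
      decide
    · rw [List.isChain_cons_cons] at hc
      simpa [toggle, headLetter] using hc.1.symm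

theorem hd_eq_four_iff {x : Cox} : hd x = 4 ↔ x = 1 := by
  constructor
  · intro h
    unfold hd at h
    rcases hx : nf x with _ | ⟨m, w⟩
    · rw [← word_nf x, hx, word_nil]
    · rw [hx] at h
      exact absurd h (Fin.castSucc_lt_last m).ne
  · rintro rfl
    simp

theorem hd_cases (x : Cox) : x = 1 ∨ ∃ l : Fin 4, hd x = l.castSucc := by
  rw [← hd_eq_four_iff]
  generalize hd x = k
  revert k
  decide

/-- Induction along reduced words. -/
theorem Cox.reducedInduction {p : Cox → Prop} (one : p 1)
    (mul : ∀ l x, hd x ≠ Fin.castSucc l → p x → p (refl l * x)) (x : Cox) : p x := by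
  generalize hn : (nf x).length = n
  induction n generalizing x with
  | zero =>
    rw [List.length_eq_zero_iff] at hn
    rw [← word_nf x, hn]
    exact one
  | succ n ih =>
    rcases hd_cases x with rfl | ⟨l, hl⟩
    · exact one
    · obtain ⟨h1, h2⟩ := nf_cons_of_hd_eq hl
      rw [← refl_mul_cancel l x]
      refine mul l _ h2 (ih _ ?_)
      rw [h1] at hn
      simpa using hn

/-! ### A left-invariant cyclic order on `Cox` -/

/-- The position of `l` after `k` in the cyclic order of `Fin 5`. -/
def cyclicRank (k l : Fin 5) : ℕ := (l - k).val

/-- The key of a word whose preceding letter is `k`; keys are compared lexicographically. -/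
def key : Fin 5 → List (Fin 4) → List ℕ
  | k, [] => [cyclicRank k 4]
  | k, l :: w => cyclicRank k l.castSucc :: key l.castSucc w

/-- The part of the key of a word that does not depend on the preceding letter. -/
def keyTail : List (Fin 4) → List ℕ
  | [] => []
  | l :: w => key l.castSucc w

theorem key_eq (k : Fin 5) (w : List (Fin 4)) :
    key k w = cyclicRank k (headLetter w) :: keyTail w := by
  cases w <;> rfl

theorem cyclicRank_injective (k : Fin 5) : Function.Injective (cyclicRank k) := by
  intro x y h
  exact sub_left_injective (Fin.val_injective h)

theorem headLetter_cons_ne (l : Fin 4) (w : List (Fin 4)) : headLetter (l :: w) ≠ 4 :=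
  (Fin.castSucc_lt_last l).ne

theorem key_injective (k : Fin 5) : Function.Injective (key k) := by
  intro v
  induction v generalizing k with
  | nil =>
    rintro (_ | ⟨m, w⟩) h
    · rfl
    · rw [key_eq, key_eq, List.cons.injEq] at h
      exact absurd (cyclicRank_injective k h.1).symm (headLetter_cons_ne m w)
  | cons l v ih =>
    rintro (_ | ⟨m, w⟩) h
    · rw [key_eq, key_eq, List.cons.injEq] at h
      exact absurd (cyclicRank_injective k h.1) (headLetter_cons_ne l v)
    · simp only [key, List.cons.injEq] at h
      obtain rfl := Fin.castSucc_injective _ (cyclicRank_injective k h.1)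
      rw [ih _ h.2]

/-- The key of an element of `Cox`. -/
def ekey (k : Fin 5) (x : Cox) : List ℕ := key k (nf x)

theorem ekey_eq (k : Fin 5) (x : Cox) :
    ekey k x = cyclicRank k (hd x) :: keyTail (nf x) := key_eq k _

theorem ekey_injective (k : Fin 5) : Function.Injective (ekey k) :=
  (key_injective k).comp nf_injective

/-- Three elements are in cyclic order, as seen from the linear order of the keys. -/
def CycAt (k : Fin 5) (x y z : Cox) : Prop :=
  (ekey k x < ekey k y ∧ ekey k y < ekey k z) ∨ (ekey k y < ekey k z ∧ ekey k z < ekey k x) ∨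
    (ekey k z < ekey k x ∧ ekey k x < ekey k y)

/-- The cyclic order on `Cox`. -/
def Cyc (x y z : Cox) : Prop := CycAt 0 x y z

theorem cyclicRank_cyclic (k m x y z : Fin 5)
    (h : (cyclicRank k x < cyclicRank k y ∧ cyclicRank k y < cyclicRank k z) ∨
      (cyclicRank k y < cyclicRank k z ∧ cyclicRank k z < cyclicRank k x) ∨
      (cyclicRank k z < cyclicRank k x ∧ cyclicRank k x < cyclicRank k y)) :
    (cyclicRank m x < cyclicRank m y ∧ cyclicRank m y < cyclicRank m z) ∨
      (cyclicRank m y < cyclicRank m z ∧ cyclicRank m z < cyclicRank m x) ∨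
      (cyclicRank m z < cyclicRank m x ∧ cyclicRank m x < cyclicRank m y) := by
  unfold cyclicRank at *
  simp only [Fin.sub_def] at *
  omega

theorem ekey_lt_iff (k : Fin 5) (x y : Cox) :
    ekey k x < ekey k y ↔ cyclicRank k (hd x) < cyclicRank k (hd y) ∨
      (hd x = hd y ∧ keyTail (nf x) < keyTail (nf y)) := by
  rw [ekey_eq, ekey_eq, List.cons_lt_cons_iff, (cyclicRank_injective k).eq_iff]

theorem ekey_lt_iff_of_hd_eq (k : Fin 5) {x y : Cox} (h : hd x = hd y) :
    ekey k x < ekey k y ↔ keyTail (nf x) < keyTail (nf y) := by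
  simp [ekey_lt_iff, h]

theorem ekey_lt_iff_of_hd_ne (k : Fin 5) {x y : Cox} (h : hd x ≠ hd y) :
    ekey k x < ekey k y ↔ cyclicRank k (hd x) < cyclicRank k (hd y) := by
  simp [ekey_lt_iff, h]

theorem CycAt.rotate {k : Fin 5} {x y z : Cox} (h : CycAt k x y z) : CycAt k y z x := by
  unfold CycAt at *
  tauto

theorem cycAt_iff_of_hd_eq (k : Fin 5) {x y z : Cox} (h : hd x = hd y) (h' : hd z ≠ hd x) :
    CycAt k x y z ↔ keyTail (nf x) < keyTail (nf y) := by
  have h1 : cyclicRank k (hd z) ≠ cyclicRank k (hd x) := (cyclicRank_injective k).ne h'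
  unfold CycAt
  rw [ekey_lt_iff_of_hd_eq k h, ekey_lt_iff_of_hd_ne k h', ekey_lt_iff_of_hd_ne k (h ▸ h'.symm),
    ← h]
  constructor
  · rintro (h | h | h)
    · exact h.1
    · omega
    · exact h.2
  · intro h
    rcases lt_or_gt_of_ne h1 with h1 | h1 <;> tauto

theorem CycAt.context {k : Fin 5} {x y z : Cox} (h : CycAt k x y z) (m : Fin 5) :
    CycAt m x y z := by
  by_cases hxy : hd x = hd y
  · by_cases hz : hd z = hd x
    · unfold CycAt at *
      rw [ekey_lt_iff_of_hd_eq _ hxy, ekey_lt_iff_of_hd_eq _ hz,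
        ekey_lt_iff_of_hd_eq _ (hxy.symm.trans hz.symm)] at *
      exact h
    · rw [cycAt_iff_of_hd_eq _ hxy hz] at *
      exact h
  by_cases hyz : hd y = hd z
  · replace h := h.rotate
    refine CycAt.rotate (CycAt.rotate ?_)
    rw [cycAt_iff_of_hd_eq _ hyz hxy] at *
    exact h
  by_cases hzx : hd z = hd x
  · replace h := h.rotate.rotate
    refine CycAt.rotate ?_
    rw [cycAt_iff_of_hd_eq _ hzx (by rw [hzx]; exact Ne.symm hxy)] at *
    exact h
  unfold CycAt at *
  rw [ekey_lt_iff_of_hd_ne _ hxy, ekey_lt_iff_of_hd_ne _ hyz, ekey_lt_iff_of_hd_ne _ hzx] at *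
  exact cyclicRank_cyclic k m _ _ _ h

theorem cyc_iff (k : Fin 5) {x y z : Cox} : Cyc x y z ↔ CycAt k x y z :=
  ⟨fun h => h.context k, fun h => h.context 0⟩

theorem Cyc.rotate {x y z : Cox} (h : Cyc x y z) : Cyc y z x := CycAt.rotate h

theorem Cyc.asymm {x y z : Cox} (h : Cyc x y z) (h' : Cyc x z y) : False := by
  unfold Cyc CycAt at *
  rcases h with h | h | h <;> rcases h' with h' | h' | h' <;> order

theorem Cyc.ne {x y z : Cox} (h : Cyc x y z) : x ≠ y := by
  rintro rfl
  unfold Cyc CycAt at h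
  rcases h with h | h | h <;> order

theorem cyc_total {x y z : Cox} (hxy : x ≠ y) (hyz : y ≠ z) (hzx : z ≠ x) :
    Cyc x y z ∨ Cyc x z y := by
  have h1 := (ekey_injective 0).ne hxy
  have h2 := (ekey_injective 0).ne hyz
  have h3 := (ekey_injective 0).ne hzx
  unfold Cyc CycAt
  rcases lt_or_gt_of_ne h1 with h1 | h1 <;> rcases lt_or_gt_of_ne h2 with h2 | h2 <;>
    rcases lt_or_gt_of_ne h3 with h3 | h3 <;> tauto

theorem ekey_dichotomy (l : Fin 4) (x : Cox) : ∃ n κ, 0 < n ∧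
    ((ekey l.castSucc x = 0 :: n :: κ ∧ ekey l.castSucc (refl l * x) = n :: κ) ∨
      (ekey l.castSucc x = n :: κ ∧ ekey l.castSucc (refl l * x) = 0 :: n :: κ)) := by
  have h0 : cyclicRank l.castSucc l.castSucc = 0 := by simp [cyclicRank]
  have hpos : ∀ m, m ≠ l.castSucc → 0 < cyclicRank l.castSucc m := fun m hm =>
    Nat.pos_of_ne_zero fun h => hm (cyclicRank_injective _ (h.trans h0.symm))
  by_cases h : hd x = l.castSucc
  · obtain ⟨h1, h2⟩ := nf_cons_of_hd_eq h
    refine ⟨_, _, hpos _ h2, Or.inl ⟨?_, ekey_eq _ _⟩⟩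
    rw [ekey, h1, key, h0, key_eq]
    rfl
  · refine ⟨_, _, hpos _ h, Or.inr ⟨ekey_eq _ _, ?_⟩⟩
    rw [ekey, nf_refl_mul_of_hd_ne h, key, h0, key_eq]
    rfl

theorem Cyc.refl_mul {x y z : Cox} (h : Cyc x y z) (l : Fin 4) :
    Cyc (refl l * x) (refl l * y) (refl l * z) := by
  rw [cyc_iff l.castSucc] at *
  unfold CycAt at *
  obtain ⟨n, κ, hn, hx⟩ := ekey_dichotomy l x
  obtain ⟨n', κ', hn', hy⟩ := ekey_dichotomy l y
  obtain ⟨n'', κ'', hn'', hz⟩ := ekey_dichotomy l z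
  rcases hx with ⟨hx, hx'⟩ | ⟨hx, hx'⟩ <;> rcases hy with ⟨hy, hy'⟩ | ⟨hy, hy'⟩ <;>
    rcases hz with ⟨hz, hz'⟩ | ⟨hz, hz'⟩ <;> rw [hx, hy, hz] at h <;> rw [hx', hy', hz'] <;>
    simp [List.cons_lt_cons_iff, hn, hn', hn'', hn.ne', hn'.ne', hn''.ne',
      hn.not_gt, hn'.not_gt, hn''.not_gt] at h ⊢ <;> tauto

theorem Cyc.mul_left {x y z : Cox} (h : Cyc x y z) (w : Cox) : Cyc (w * x) (w * y) (w * z) := by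
  induction w using Cox.induction with
  | one => simpa using h
  | mul j w ih => simpa only [mul_assoc] using ih.refl_mul j

theorem cyc_mul_left_iff {x y z : Cox} (w : Cox) :
    Cyc (w * x) (w * y) (w * z) ↔ Cyc x y z :=
  ⟨fun h => by simpa using h.mul_left w⁻¹, fun h => h.mul_left w⟩

/-! ### Automorphisms of `Cox` preserving the cyclic order -/

/-- The endomorphism of `Cox` with `s_p ↦ s_p s_q s_p`, `s_q ↦ s_p`, fixing the other
generators. -/
def twistHom (p q : Fin 4) : Cox →* Cox :=
  Cox.lift (fun j => if j = p then refl p * refl q * refl p else if j = q then refl p else refl j)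
    (fun j => by split_ifs <;> simp [mul_assoc])

theorem twistHom_left (p q : Fin 4) : twistHom p q (refl p) = refl p * refl q * refl p := by
  simp [twistHom]

theorem twistHom_right {p q : Fin 4} (h : p ≠ q) : twistHom p q (refl q) = refl p := by
  simp [twistHom, h.symm]

theorem twistHom_of_ne {p q j : Fin 4} (hp : j ≠ p) (hq : j ≠ q) :
    twistHom p q (refl j) = refl j := by
  simp [twistHom, hp, hq]

theorem twistHom_comp_twistHom {p q : Fin 4} (h : p ≠ q) :
    (twistHom p q).comp (twistHom q p) = MonoidHom.id _ := by
  refine Cox.hom_ext fun j => ?_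
  by_cases hp : j = p
  · subst hp
    simp [twistHom_right h.symm, twistHom_right h]
  · by_cases hq : j = q
    · subst hq
      simp [twistHom_left, twistHom_right h, mul_assoc]
    · simp [twistHom_of_ne hp hq, twistHom_of_ne hq hp]

/-- The half twist `s_p ↦ s_p s_q s_p`, `s_q ↦ s_p`, as an automorphism of `Cox`. -/
def twist (p q : Fin 4) (h : p ≠ q) : MulAut Cox :=
  MonoidHom.toMulEquiv (twistHom p q) (twistHom q p) (twistHom_comp_twistHom h.symm)
    (twistHom_comp_twistHom h)

theorem twist_apply {p q : Fin 4} (h : p ≠ q) (x : Cox) : twist p q h x = twistHom p q x := rfl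

theorem hd_twistHom_aux {p q : Fin 4} (h : p ≠ q) (x : Cox) :
    (hd x ≠ p.castSucc → hd x ≠ q.castSucc → hd (twistHom p q x) = hd x) ∧
    (hd x = p.castSucc → ∃ w, nf (twistHom p q x) = p :: q :: w) ∧
    (hd x = q.castSucc → (hd (twistHom p q x) = q.castSucc ∨
      ∃ w, nf (twistHom p q x) = p :: w ∧ headLetter w ≠ q.castSucc)) := by
  have hinj : ∀ {i j : Fin 4}, i.castSucc = j.castSucc → i = j := fun e =>
    Fin.castSucc_injective _ e
  induction x using Cox.reducedInduction with
  | one =>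
    refine ⟨by simp, fun h => absurd h ?_, fun h => absurd h ?_⟩ <;>
    · rw [hd_one]
      exact (Fin.castSucc_lt_last _).ne'
  | mul l x hl ih =>
    obtain ⟨ih1, ih2, ih3⟩ := ih
    rw [hd_refl_mul_of_hd_ne hl, map_mul]
    by_cases hp : l = p
    · subst hp
      refine ⟨fun h => absurd rfl h, fun _ => ?_, fun e => absurd (hinj e) h⟩
      rw [twistHom_left, mul_assoc, mul_assoc]
      by_cases hq : hd x = q.castSucc
      · rcases ih3 hq with h1 | ⟨w, hw, hw'⟩
        · have h2 : hd (twistHom l q x) ≠ l.castSucc := by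
            rw [h1]
            exact fun e => h (hinj e.symm)
          have h3 : hd (refl l * twistHom l q x) ≠ q.castSucc := by
            rw [hd_refl_mul_of_hd_ne h2]
            exact fun e => h (hinj e)
          have h4 : hd (refl q * (refl l * twistHom l q x)) ≠ l.castSucc := by
            rw [hd_refl_mul_of_hd_ne h3]
            exact fun e => h (hinj e.symm)
          exact ⟨_, by rw [nf_refl_mul_of_hd_ne h4, nf_refl_mul_of_hd_ne h3]⟩
        · have h2 : nf (refl l * twistHom l q x) = w := by
            rw [nf_refl_mul, hw]
            simp [toggle]
          have h3 : hd (refl l * twistHom l q x) ≠ q.castSucc := by rwa [hd, h2]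
          have h4 : hd (refl q * (refl l * twistHom l q x)) ≠ l.castSucc := by
            rw [hd_refl_mul_of_hd_ne h3]
            exact fun e => h (hinj e.symm)
          exact ⟨_, by rw [nf_refl_mul_of_hd_ne h4, nf_refl_mul_of_hd_ne h3]⟩
      · have h1 := ih1 hl hq
        have h2 : hd (twistHom l q x) ≠ l.castSucc := by rwa [h1]
        have h3 : hd (refl l * twistHom l q x) ≠ q.castSucc := by
          rw [hd_refl_mul_of_hd_ne h2]
          exact fun e => h (hinj e)
        have h4 : hd (refl q * (refl l * twistHom l q x)) ≠ l.castSucc := by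
          rw [hd_refl_mul_of_hd_ne h3]
          exact fun e => h (hinj e.symm)
        exact ⟨_, by rw [nf_refl_mul_of_hd_ne h4, nf_refl_mul_of_hd_ne h3]⟩
    · by_cases hq : l = q
      · subst hq
        refine ⟨fun _ h => absurd rfl h, fun e => absurd (hinj e) hp, fun _ => ?_⟩
        rw [twistHom_right h]
        by_cases hx : hd x = p.castSucc
        · obtain ⟨w, hw⟩ := ih2 hx
          left
          rw [hd, nf_refl_mul, hw]
          simp [toggle, headLetter]
        · have h1 := ih1 hx hl
          refine Or.inr ⟨_, nf_refl_mul_of_hd_ne (by rwa [h1]), ?_⟩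
          rwa [← hd, h1]
      · refine ⟨fun _ _ => ?_, fun e => absurd (hinj e) hp, fun e => absurd (hinj e) hq⟩
        rw [twistHom_of_ne hp hq]
        refine hd_refl_mul_of_hd_ne ?_
        by_cases hx : hd x = p.castSucc
        · obtain ⟨w, hw⟩ := ih2 hx
          rw [hd, hw]
          exact fun e => hp (hinj e.symm)
        · by_cases hx' : hd x = q.castSucc
          · rcases ih3 hx' with h1 | ⟨w, hw, -⟩
            · rw [h1]
              exact fun e => hq (hinj e.symm)
            · rw [hd, hw]
              exact fun e => hp (hinj e.symm)
          · rwa [ih1 hx hx']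

theorem ekey_twistHom_lt {p q : Fin 4} (h : p ≠ q) (hpq : cyclicRank p.castSucc q.castSucc = 1)
    {x y : Cox} (hxy : hd x ≠ hd y) (hlt : ekey p.castSucc x < ekey p.castSucc y) :
    ekey p.castSucc (twistHom p q x) < ekey p.castSucc (twistHom p q y) := by
  rw [ekey_lt_iff_of_hd_ne _ hxy] at hlt
  have hpp : cyclicRank p.castSucc p.castSucc = 0 := by simp [cyclicRank]
  have hpos : ∀ m, m ≠ p.castSucc → 0 < cyclicRank p.castSucc m := fun m hm =>
    Nat.pos_of_ne_zero fun h => hm (cyclicRank_injective _ (h.trans hpp.symm))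
  have hne : ∀ m, m ≠ q.castSucc → cyclicRank p.castSucc m ≠ 1 := fun m hm h =>
    hm (cyclicRank_injective _ (h.trans hpq.symm))
  have key_p : ∀ z, hd z = p.castSucc →
      ∃ κ, ekey p.castSucc (twistHom p q z) = 0 :: 1 :: κ := fun z hz => by
    obtain ⟨w, hw⟩ := (hd_twistHom_aux h z).2.1 hz
    exact ⟨_, by rw [ekey, hw, key, key, hpp, hpq]⟩
  have key_q : ∀ z, hd z = q.castSucc →
      (∃ n κ, 1 < n ∧ ekey p.castSucc (twistHom p q z) = 0 :: n :: κ) ∨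
      ∃ κ, ekey p.castSucc (twistHom p q z) = 1 :: κ := fun z hz => by
    rcases (hd_twistHom_aux h z).2.2 hz with h1 | ⟨w, hw, hw'⟩
    · exact Or.inr ⟨_, by rw [ekey_eq, h1, hpq]⟩
    · have hc := isChain_nf (twistHom p q z)
      have hw'' : headLetter w ≠ p.castSucc := by
        rw [hw] at hc
        rcases w with _ | ⟨m, w⟩
        · exact (Fin.castSucc_lt_last _).ne'
        · rw [List.isChain_cons_cons] at hc
          exact fun e => hc.1 (Fin.castSucc_injective _ e).symm
      refine Or.inl ⟨_, _, ?_, by rw [ekey, hw, key, hpp, key_eq]⟩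
      have h1 := hpos _ hw''
      have h2 := hne _ hw'
      omega
  have key_o : ∀ z, hd z ≠ p.castSucc → hd z ≠ q.castSucc →
      ∃ κ, ekey p.castSucc (twistHom p q z) = cyclicRank p.castSucc (hd z) :: κ :=
    fun z hz hz' => ⟨_, by rw [ekey_eq, (hd_twistHom_aux h z).1 hz hz']⟩
  have hyp : hd y ≠ p.castSucc := fun e => by simp [e, hpp] at hlt
  by_cases hxp : hd x = p.castSucc
  · obtain ⟨κ, hκ⟩ := key_p x hxp
    by_cases hyq : hd y = q.castSucc
    · rcases key_q y hyq with ⟨n, κ', hn, hκ'⟩ | ⟨κ', hκ'⟩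
      · simp [hκ, hκ', List.cons_lt_cons_iff, hn]
      · simp [hκ, hκ', List.cons_lt_cons_iff]
    · obtain ⟨κ', hκ'⟩ := key_o y hyp hyq
      simp [hκ, hκ', List.cons_lt_cons_iff, hpos _ hyp]
  · have h1 := hpos _ hxp
    have hyq : hd y ≠ q.castSucc := fun e => by
      rw [e, hpq] at hlt
      omega
    obtain ⟨κ', hκ'⟩ := key_o y hyp hyq
    by_cases hxq : hd x = q.castSucc
    · have h2 := hpos _ hyp
      have h3 := hne _ hyq
      rcases key_q x hxq with ⟨n, κ, hn, hκ⟩ | ⟨κ, hκ⟩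
      · simp [hκ, hκ', List.cons_lt_cons_iff, h2]
      · rw [hκ, hκ', List.cons_lt_cons_iff]
        left
        omega
    · obtain ⟨κ, hκ⟩ := key_o x hxp hxq
      simp [hκ, hκ', List.cons_lt_cons_iff, hlt]

theorem length_nf_refl_mul_le (l : Fin 4) {x : Cox} (h : hd x = l.castSucc) :
    (nf x).length = (nf (refl l * x)).length + 1 := by
  rw [(nf_cons_of_hd_eq h).1, List.length_cons]

theorem length_nf_refl_mul_le' (l : Fin 4) (x : Cox) :
    (nf (refl l * x)).length ≤ (nf x).length + 1 := by
  by_cases h : hd x = l.castSucc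
  · have := length_nf_refl_mul_le l h
    omega
  · rw [nf_refl_mul_of_hd_ne h, List.length_cons]

theorem Cyc.twistHom {p q : Fin 4} (h : p ≠ q) (hpq : cyclicRank p.castSucc q.castSucc = 1)
    {x y z : Cox} (hc : Cyc x y z) :
    Cyc (twistHom p q x) (twistHom p q y) (twistHom p q z) := by
  generalize hn : (nf x).length + (nf y).length + (nf z).length = n
  induction n using Nat.strong_induction_on generalizing x y z with
  | _ n ih =>
  have step : ∀ {x y z : Cox}, Cyc x y z →
      (nf x).length + (nf y).length + (nf z).length = n → hd x = hd y →
      Cyc (D4Artin.twistHom p q x) (D4Artin.twistHom p q y) (D4Artin.twistHom p q z) := by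
    intro x y z hc hn hxy
    rcases hd_cases x with rfl | ⟨l, hl⟩
    · rw [hd_one] at hxy
      exact absurd (hd_eq_four_iff.1 hxy.symm).symm hc.ne
    · have h1 := length_nf_refl_mul_le l hl
      have h2 := length_nf_refl_mul_le l (hxy ▸ hl)
      have h3 := length_nf_refl_mul_le' l z
      have := ih _ (by omega) (hc.refl_mul l) rfl
      rw [map_mul, map_mul, map_mul] at this
      exact (cyc_mul_left_iff _).1 this
  by_cases hxy : hd x = hd y
  · exact step hc hn hxy
  by_cases hyz : hd y = hd z
  · exact (step hc.rotate (by omega) hyz).rotate.rotate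
  by_cases hzx : hd z = hd x
  · exact (step hc.rotate.rotate (by omega) hzx).rotate
  rw [cyc_iff p.castSucc] at *
  have H := fun {x y : Cox} => @ekey_twistHom_lt p q h hpq x y
  rcases hc with ⟨h1, h2⟩ | ⟨h1, h2⟩ | ⟨h1, h2⟩
  · exact Or.inl ⟨H hxy h1, H hyz h2⟩
  · exact Or.inr (Or.inl ⟨H hyz h1, H hzx h2⟩)
  · exact Or.inr (Or.inr ⟨H hzx h1, H hxy h2⟩)

/-- The automorphisms of `Cox` preserving the cyclic order. -/
def cycAut : Subgroup (MulAut Cox) where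
  carrier := { α | ∀ x y z, Cyc (α x) (α y) (α z) ↔ Cyc x y z }
  one_mem' := fun _ _ _ => Iff.rfl
  mul_mem' := fun {α β} hα hβ x y z => (hα _ _ _).trans (hβ _ _ _)
  inv_mem' := fun {α} hα x y z => by
    rw [← hα]
    simp

theorem mem_cycAut_of_forall {α : MulAut Cox}
    (h : ∀ x y z, Cyc x y z → Cyc (α x) (α y) (α z)) : α ∈ cycAut := by
  refine fun x y z => ⟨fun h1 => ?_, h x y z⟩
  have hne {x y : Cox} (h1 : α x ≠ α y) : x ≠ y := fun e => h1 (e ▸ rfl)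
  rcases cyc_total (hne h1.ne) (hne h1.rotate.ne) (hne h1.rotate.rotate.ne) with h2 | h2
  · exact h2
  · exact (h1.asymm (h _ _ _ h2)).elim

theorem twist_mem_cycAut {p q : Fin 4} (h : p ≠ q)
    (hpq : cyclicRank p.castSucc q.castSucc = 1) : twist p q h ∈ cycAut :=
  mem_cycAut_of_forall fun _ _ _ hc => hc.twistHom h hpq

/-! ### Unlinked subgroups -/

/-- The cosets of `H` are pairwise unlinked in the cyclic order. -/
def Unlinked (H : Subgroup Cox) : Prop :=
  ∀ x x' y y', Cyc x x' y → Cyc x y y' → x⁻¹ * y ∈ H → x'⁻¹ * y' ∈ H → x⁻¹ * x' ∈ H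

/-- The subgroup of `Cox` generated by the first three generators. -/
def coxThree : Subgroup Cox := Subgroup.closure { x | ∃ j : Fin 4, j ≠ 3 ∧ x = refl j }

theorem refl_mem_coxThree {j : Fin 4} (hj : j ≠ 3) : refl j ∈ coxThree :=
  Subgroup.subset_closure ⟨j, hj, rfl⟩

theorem word_mem_coxThree {w : List (Fin 4)} (hw : 3 ∉ w) : word w ∈ coxThree := by
  induction w with
  | nil => exact one_mem _
  | cons j w ih =>
    rw [List.mem_cons, not_or] at hw
    rw [word_cons]
    exact mul_mem (refl_mem_coxThree (Ne.symm hw.1)) (ih hw.2)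

theorem mem_coxThree_iff {x : Cox} : x ∈ coxThree ↔ 3 ∉ nf x := by
  constructor
  · intro hx
    have step : ∀ j : Fin 4, j ≠ 3 → ∀ w, 3 ∉ w → 3 ∉ toggle j w := by
      intro j hj w hw
      rcases w with _ | ⟨l, w⟩
      · simpa [toggle] using hj.symm
      · rw [List.mem_cons, not_or] at hw
        by_cases h : l = j <;> simp [toggle, h, hw.1, hw.2, hj.symm]
    unfold coxThree at hx
    induction hx using Subgroup.closure_induction_left with
    | one => simp
    | mul_left y hy z _ ih =>
      obtain ⟨j, hj, rfl⟩ := hy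
      rw [nf_refl_mul]
      exact step j hj _ ih
    | inv_mul_cancel y hy z _ ih =>
      obtain ⟨j, hj, rfl⟩ := hy
      rw [refl_inv, nf_refl_mul]
      exact step j hj _ ih
  · intro h
    rw [← word_nf x]
    exact word_mem_coxThree h

theorem hd_ne_three_of_mem {x : Cox} (hx : x ∈ coxThree) : hd x ≠ Fin.castSucc 3 := fun h => by
  rw [mem_coxThree_iff, (nf_cons_of_hd_eq h).1] at hx
  exact hx List.mem_cons_self

theorem hd_mul_of_three_mem {x k : Cox} (hx : 3 ∈ nf x) (hk : k ∈ coxThree) :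
    hd (x * k) = hd x := by
  induction x using Cox.reducedInduction with
  | one => simp at hx
  | mul l x hl ih =>
    rw [hd_refl_mul_of_hd_ne hl, mul_assoc]
    apply hd_refl_mul_of_hd_ne
    by_cases h : 3 ∈ nf x
    · rwa [ih h]
    · rw [nf_refl_mul_of_hd_ne hl, List.mem_cons] at hx
      obtain rfl : 3 = l := by tauto
      exact hd_ne_three_of_mem (mul_mem (mem_coxThree_iff.2 h) hk)

theorem ekey_three_lt {x y : Cox} (hx : hd x = Fin.castSucc 3) (hy : hd y ≠ Fin.castSucc 3) :
    ekey (Fin.castSucc 3) x < ekey (Fin.castSucc 3) y := by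
  rw [ekey_lt_iff_of_hd_ne _ (by rw [hx]; exact hy.symm), hx]
  have h0 : cyclicRank (Fin.castSucc 3) (Fin.castSucc (3 : Fin 4)) = 0 := by simp [cyclicRank]
  rw [h0]
  exact Nat.pos_of_ne_zero fun h => hy (cyclicRank_injective _ (h.trans h0.symm))

theorem unlinked_coxThree : Unlinked coxThree := by
  suffices H : ∀ x' x y k, x ∈ coxThree → y ∈ coxThree → k ∈ coxThree → Cyc x x' y →
      Cyc x y (x' * k) → x' ∈ coxThree by
    intro x x' y y' h1 h2 h3 h4
    refine H (x⁻¹ * x') 1 (x⁻¹ * y) (x'⁻¹ * y') (one_mem _) h3 h4 ?_ ?_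
    · simpa using h1.mul_left x⁻¹
    · simpa [mul_assoc] using h2.mul_left x⁻¹
  intro x'
  induction x' using Cox.reducedInduction with
  | one => exact fun _ _ _ _ _ _ _ _ => one_mem _
  | mul l x' hl ih =>
    intro x y k hx hy hk h1 h2
    by_cases h : l = 3
    · subst h
      have e1 : hd (refl 3 * x') = Fin.castSucc 3 := hd_refl_mul_of_hd_ne hl
      have e2 : hd (refl 3 * x' * k) = Fin.castSucc 3 := by
        rw [hd_mul_of_three_mem _ hk, e1]
        rw [nf_refl_mul_of_hd_ne hl]
        exact List.mem_cons_self
      have hx' := hd_ne_three_of_mem hx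
      have hy' := hd_ne_three_of_mem hy
      rw [cyc_iff (Fin.castSucc 3)] at h1 h2
      have l1 := ekey_three_lt e1 hx'
      have l2 := ekey_three_lt e1 hy'
      have l3 := ekey_three_lt e2 hx'
      have l4 := ekey_three_lt e2 hy'
      rcases h1 with h1 | h1 | h1 <;> rcases h2 with h2 | h2 | h2 <;> order
    · have hl' := refl_mem_coxThree h
      refine mul_mem hl' (ih (refl l * x) (refl l * y) k (mul_mem hl' hx) (mul_mem hl' hy) hk ?_ ?_)
      · simpa using h1.refl_mul l
      · simpa [mul_assoc] using h2.refl_mul l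

theorem Unlinked.smul {H : Subgroup Cox} (hH : Unlinked H) {α : MulAut Cox} (hα : α ∈ cycAut) :
    Unlinked (α • H) := by
  intro x x' y y' h1 h2 h3 h4
  simp only [Subgroup.mem_pointwise_smul_iff_inv_smul_mem, MulAut.smul_def, map_mul, map_inv]
    at h3 h4 ⊢
  have hα' := inv_mem hα
  exact hH _ _ _ _ ((hα' _ _ _).2 h1) ((hα' _ _ _).2 h2) h3 h4

/-- The subgroup `H` is generated by elements of order at most two. -/
def InvolutionGenerated (H : Subgroup Cox) : Prop :=
  ∃ S : Set Cox, (∀ x ∈ S, x * x = 1) ∧ H = Subgroup.closure S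

theorem involutionGenerated_coxThree : InvolutionGenerated coxThree :=
  ⟨_, by rintro _ ⟨j, -, rfl⟩; exact refl_mul_self j, rfl⟩

theorem InvolutionGenerated.smul {H : Subgroup Cox} (hH : InvolutionGenerated H)
    (α : MulAut Cox) : InvolutionGenerated (α • H) := by
  obtain ⟨S, hS, rfl⟩ := hH
  refine ⟨α • S, ?_, Subgroup.smul_closure α S⟩
  rintro _ ⟨x, hx, rfl⟩
  simp only [MulAut.smul_def]
  rw [← map_mul, hS x hx, map_one]

section Counting

variable {H : Subgroup Cox} (C : Cox ⧸ H)

open Classical in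
/-- The counter of the steps between cosets along the generator `s_3`, with respect to `C`. -/
noncomputable def crossing (j : Fin 4) (D : Cox ⧸ H) : ℤ :=
  if j = 3 then (if D = C then 1 else 0) - (if refl j • D = C then 1 else 0) else 0

theorem crossing_add (j : Fin 4) (D : Cox ⧸ H) :
    crossing C j D + crossing C j (refl j • D) = 0 := by
  unfold crossing
  rw [smul_smul, refl_mul_self, one_smul]
  split_ifs <;> simp

/-- The action of a generator on cosets together with a counter. -/
noncomputable def countPerm (j : Fin 4) : Equiv.Perm ((Cox ⧸ H) × ℤ) :=
  Function.Involutive.toPerm (fun D => (refl j • D.1, D.2 + crossing C j D.1)) (fun D => by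
    ext
    · simp [smul_smul]
    · have := crossing_add C j D.1
      simp only
      linarith)

/-- The action of `Cox` on cosets together with a counter. -/
noncomputable def countAction : Cox →* Equiv.Perm ((Cox ⧸ H) × ℤ) :=
  Cox.lift (countPerm C) (fun j => by
    ext1 D
    exact Function.Involutive.toPerm_involutive _ D)

theorem countAction_refl_mul (j : Fin 4) (x : Cox) (D : (Cox ⧸ H) × ℤ) :
    countAction C (refl j * x) D =
      (refl j • (countAction C x D).1,
        (countAction C x D).2 + crossing C j (countAction C x D).1) := by
  rw [map_mul, Equiv.Perm.mul_apply]
  conv_lhs => rw [countAction, Cox.lift_refl]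
  rfl

/-- The total counter of an element of `Cox`, starting from a coset. -/
noncomputable def count (x : Cox) (D : Cox ⧸ H) : ℤ := (countAction C x (D, 0)).2

theorem countAction_apply (x : Cox) (D : Cox ⧸ H) (n : ℤ) :
    countAction C x (D, n) = (x • D, n + count C x D) := by
  unfold count
  induction x using Cox.induction generalizing n with
  | one => simp
  | mul j x ih =>
    rw [countAction_refl_mul, countAction_refl_mul, ih n, ih 0, mul_smul]
    simp only [zero_add, add_assoc]

theorem count_one (D : Cox ⧸ H) : count C 1 D = 0 := by simp [count]

theorem count_mul (x y : Cox) (D : Cox ⧸ H) :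
    count C (x * y) D = count C y D + count C x (y • D) := by
  rw [count, map_mul, Equiv.Perm.mul_apply, countAction_apply, countAction_apply]
  simp

theorem count_refl (j : Fin 4) (D : Cox ⧸ H) : count C (refl j) D = crossing C j D := by
  have := countAction_refl_mul C j 1 (D, 0)
  rw [mul_one] at this
  simp [count, this]

theorem smul_coset_one {x : Cox} (hx : x ∈ H) : x • ((1 : Cox) : Cox ⧸ H) = (1 : Cox) := by
  change ((x * 1 : Cox) : Cox ⧸ H) = _
  rw [QuotientGroup.eq]
  simpa using inv_mem hx

theorem count_of_mem (hH : InvolutionGenerated H) {x : Cox} (hx : x ∈ H) :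
    count C x (1 : Cox) = 0 := by
  obtain ⟨S, hS, hHS⟩ := hH
  have hx' : x ∈ Subgroup.closure S := hHS ▸ hx
  induction hx' using Subgroup.closure_induction with
  | one => exact count_one C _
  | mem y hy =>
    have h := count_mul C y y (1 : Cox)
    rw [hS y hy, count_one, smul_coset_one (hHS ▸ Subgroup.subset_closure hy)] at h
    omega
  | mul y z hy hz ihy ihz =>
    rw [← hHS] at hy hz
    rw [count_mul, smul_coset_one hz, ihy hy, ihz hz, add_zero]
  | inv y hy ih =>
    rw [← hHS] at hy
    have h := count_mul C y⁻¹ y (1 : Cox)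
    rw [inv_mul_cancel, count_one, smul_coset_one hy, ih hy] at h
    omega

theorem count_word_inv_nonneg (w : List (Fin 4)) (D : Cox ⧸ H)
    (h : ∀ p, p ++ [3] <+: w → (refl 3 * (word p)⁻¹) • D ≠ C) :
    0 ≤ count C (word w)⁻¹ D ∧
      ∀ p, p ++ [3] <+: w → (word p)⁻¹ • D = C → 0 < count C (word w)⁻¹ D := by
  induction w generalizing D with
  | nil => simp [count_one]
  | cons j w ih =>
    have hc : 0 ≤ crossing C j D := by
      unfold crossing
      by_cases hj : j = 3
      · subst hj
        have := h [] (by simp)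
        simp only [word_nil, inv_one, mul_one] at this
        simp only [this, if_true, if_false]
        split_ifs <;> simp
      · simp [hj]
    obtain ⟨ih1, ih2⟩ := ih (refl j • D) (fun p hp => by
      have := h (j :: p) (by simpa using hp)
      rwa [word_cons, mul_inv_rev, refl_inv, ← mul_assoc, mul_smul] at this)
    rw [word_cons, mul_inv_rev, refl_inv, count_mul, count_refl]
    refine ⟨by omega, fun p hp hpC => ?_⟩
    rcases p with _ | ⟨i, p⟩
    · obtain rfl : 3 = j := by simpa using hp
      have := h [] (by simp)
      simp only [word_nil, inv_one, mul_one, one_smul] at this hpC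
      have hcr : crossing C 3 D = 1 := by
        rw [crossing, if_pos rfl, if_pos hpC, if_neg this, sub_zero]
      omega
    · obtain ⟨rfl, -⟩ : i = j ∧ p ++ [3] <+: w := by simpa using hp
      replace hp : p ++ [3] <+: w := by simpa using hp
      rw [word_cons, mul_inv_rev, refl_inv, mul_smul] at hpC
      have := ih2 p hp hpC
      omega

end Counting

theorem exists_partner {H : Subgroup Cox} (hH : InvolutionGenerated H) {w : List (Fin 4)}
    (hw : word w ∈ H) {p : List (Fin 4)} (hp : p ++ [3] <+: w) :
    ∃ p', p' ++ [3] <+: w ∧ word p' * refl 3 * (word p)⁻¹ ∈ H := by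
  by_contra! hcon
  have h0 := count_of_mem ((word p)⁻¹ : Cox) hH (inv_mem hw)
  have h1 := (count_word_inv_nonneg (((word p)⁻¹ : Cox) : Cox ⧸ H) w ((1 : Cox) : Cox ⧸ H) ?_).2
    p hp ?_
  · omega
  · intro q hq he
    refine hcon q hq ?_
    change ((refl 3 * (word q)⁻¹ * 1 : Cox) : Cox ⧸ H) = _ at he
    rw [QuotientGroup.eq] at he
    simpa [mul_assoc] using he
  · change (((word p)⁻¹ * 1 : Cox) : Cox ⧸ H) = _
    rw [mul_one]

/-! ### A Helly property for the cosets of unlinked subgroups -/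

theorem word_inv_props {p : List (Fin 4)} (hp : (p ++ [3]).IsChain (· ≠ ·)) :
    nf (word p)⁻¹ = p.reverse ∧ hd (word p)⁻¹ ≠ Fin.castSucc 3 := by
  have hr : (p ++ [3]).reverse.IsChain (· ≠ ·) := by
    rw [List.isChain_reverse]
    exact hp.imp fun _ _ h => h.symm
  rw [List.reverse_append, List.reverse_singleton, List.singleton_append] at hr
  have h1 : nf (word p)⁻¹ = p.reverse := by
    rw [← word_reverse]
    exact nf_word hr.tail
  refine ⟨h1, ?_⟩
  rw [hd, h1]
  rcases hq : p.reverse with _ | ⟨l, q⟩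
  · exact (Fin.castSucc_lt_last _).ne'
  · rw [hq, List.isChain_cons_cons] at hr
    exact fun e => hr.1 (Fin.castSucc_injective _ e).symm

theorem ekey_refl_three {x : Cox} (hx : hd x ≠ Fin.castSucc 3) :
    ekey (Fin.castSucc 3) (refl 3 * x) = 0 :: ekey (Fin.castSucc 3) x := by
  rw [ekey, nf_refl_mul_of_hd_ne hx, key, cyclicRank, sub_self]
  rfl

/-- The extreme occurrences of the letter `3` in a word representing an element of an unlinked
subgroup are matched with each other. -/
theorem extreme_pair_mem {H : Subgroup Cox} (hU : Unlinked H) (hI : InvolutionGenerated H)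
    {w : List (Fin 4)} (hw : word w ∈ H)
    (hch : ∀ r, r ++ [3] <+: w → (r ++ [3]).IsChain (· ≠ ·))
    {p q : List (Fin 4)} (hp : p ++ [3] <+: w) (hq : q ++ [3] <+: w)
    (hmin : ∀ r, r ++ [3] <+: w →
      ekey (Fin.castSucc 3) (word p)⁻¹ ≤ ekey (Fin.castSucc 3) (word r)⁻¹)
    (hmax : ∀ r, r ++ [3] <+: w →
      ekey (Fin.castSucc 3) (word r)⁻¹ ≤ ekey (Fin.castSucc 3) (word q)⁻¹) :
    word q * refl 3 * (word p)⁻¹ ∈ H := by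
  obtain ⟨j, hj, hjH⟩ := exists_partner hI hw hp
  obtain ⟨i, hi, hiH⟩ := exists_partner hI hw hq
  have hiH' : word q * refl 3 * (word i)⁻¹ ∈ H := by
    simpa [mul_assoc] using inv_mem hiH
  by_cases hpi : (word p)⁻¹ = (word i)⁻¹
  · rwa [hpi]
  by_cases hjq : (word j)⁻¹ = (word q)⁻¹
  · rwa [inv_inj.1 hjq] at hjH
  have nep := (word_inv_props (hch p hp)).2
  have nei := (word_inv_props (hch i hi)).2
  have nej := (word_inv_props (hch j hj)).2
  have neq := (word_inv_props (hch q hq)).2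
  have lt1 := lt_of_le_of_ne (hmin i hi) ((ekey_injective _).ne hpi)
  have lt2 := lt_of_le_of_ne (hmax j hj) ((ekey_injective _).ne hjq)
  have lt3 : ekey (Fin.castSucc 3) (refl 3 * (word j)⁻¹) <
      ekey (Fin.castSucc 3) (refl 3 * (word q)⁻¹) := by
    rw [ekey_refl_three nej, ekey_refl_three neq]
    exact List.cons_lt_cons_iff.2 (Or.inr ⟨rfl, lt2⟩)
  have lt4 := ekey_three_lt (hd_refl_mul_of_hd_ne neq) nep
  have key := hU (refl 3 * (word j)⁻¹) (refl 3 * (word q)⁻¹) (word p)⁻¹ (word i)⁻¹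
    ((cyc_iff _).2 (Or.inl ⟨lt3, lt4⟩)) ((cyc_iff _).2 (Or.inl ⟨lt3.trans lt4, lt1⟩))
    (by simpa [mul_assoc] using hjH) (by simpa [mul_assoc] using hiH')
  have := mul_mem (inv_mem key) hjH
  simpa [mul_assoc] using this

theorem count_three_toggle_le (j : Fin 4) (w : List (Fin 4)) :
    (toggle j w).count 3 ≤ (j :: w).count 3 := by
  rcases w with _ | ⟨l, w⟩
  · simp [toggle]
  · by_cases h : l = j
    · simp only [toggle, h, if_true, List.count_cons]
      omega
    · simp [toggle, h]

theorem count_three_nf_word_le (w : List (Fin 4)) : (nf (word w)).count 3 ≤ w.count 3 := by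
  induction w with
  | nil => simp
  | cons j w ih =>
    rw [word_cons, nf_refl_mul]
    refine (count_three_toggle_le _ _).trans ?_
    rw [List.count_cons, List.count_cons]
    omega

theorem count_three_shorten_lt {w p q : List (Fin 4)} (hp : p ++ [3] <+: w)
    (hq : q ++ [3] <+: w) (hle : p.length ≤ q.length) :
    (nf ((word q * refl 3 * (word p)⁻¹)⁻¹ * word w)).count 3 < w.count 3 := by
  obtain ⟨s, rfl⟩ := hq
  have hpq : p <+: q := List.prefix_of_prefix_length_le
    ((List.prefix_append p _).trans hp) (by simp) hle
  have e : (word q * refl 3 * (word p)⁻¹)⁻¹ * word (q ++ [3] ++ s) = word (p ++ s) := by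
    simp [mul_assoc]
  rw [e]
  refine (count_three_nf_word_le _).trans_lt ?_
  have := hpq.sublist.count_le 3
  simp only [List.count_append, List.count_singleton_self]
  omega

theorem helly_aux {H₁ H₅ : Subgroup Cox} (U₁ : Unlinked H₁) (I₁ : InvolutionGenerated H₁)
    (U₅ : Unlinked H₅) (I₅ : InvolutionGenerated H₅) {y k : Cox} (hy : y ∈ H₁)
    (hk : k ∈ coxThree) (hyk : y * k ∈ H₅) : ∃ q, q ∈ H₁ ∧ q ∈ H₅ ∧ q⁻¹ * y ∈ coxThree := by
  generalize hn : (nf y).count 3 = n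
  induction n using Nat.strong_induction_on generalizing y with
  | _ n ih =>
  by_cases h3 : 3 ∈ nf y
  swap
  · exact ⟨1, one_mem _, one_mem _, by simpa using mem_coxThree_iff.2 h3⟩
  have step : ∀ g ∈ H₁, g ∈ H₅ → (nf (g⁻¹ * y)).count 3 < n →
      ∃ q, q ∈ H₁ ∧ q ∈ H₅ ∧ q⁻¹ * y ∈ coxThree := by
    intro g h1 h5 hlt
    obtain ⟨q, q1, q5, hq⟩ := ih _ hlt (mul_mem (inv_mem h1) hy)
      (by simpa [mul_assoc] using mul_mem (inv_mem h5) hyk) rfl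
    exact ⟨g * q, mul_mem h1 q1, mul_mem h5 q5, by simpa [mul_assoc] using hq⟩
  set P : Set (List (Fin 4)) := { p | p ++ [3] <+: nf y } with hP
  have hfin : P.Finite := by
    refine (List.finite_toSet (nf y).inits).subset fun p hp => ?_
    exact (List.mem_inits _ _).2 ((List.prefix_append p _).trans hp)
  have hne : P.Nonempty := by
    obtain ⟨p, s, hps⟩ := List.append_of_mem h3
    exact ⟨p, s, by rw [hps]; simp⟩
  obtain ⟨p, hp, hmin⟩ := Set.exists_min_image P
    (fun r => ekey (Fin.castSucc 3) (word r)⁻¹) hfin hne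
  obtain ⟨q, hq, hmax⟩ := Set.exists_max_image P
    (fun r => ekey (Fin.castSucc 3) (word r)⁻¹) hfin hne
  have hch : ∀ r, r ++ [3] <+: nf y → (r ++ [3]).IsChain (· ≠ ·) := fun r ⟨t, ht⟩ =>
    List.IsChain.left_of_append (ht ▸ isChain_nf y)
  have hk3 := mem_coxThree_iff.1 hk
  have hext : ∀ r, r ++ [3] <+: nf y ++ nf k ↔ r ++ [3] <+: nf y := by
    refine fun r => ⟨fun h => ?_, fun h => h.trans (List.prefix_append _ _)⟩
    rcases le_or_gt (r ++ [3]).length (nf y).length with hl | hl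
    · exact List.prefix_of_prefix_length_le h (List.prefix_append _ _) hl
    · have h' : nf y <+: r := by
        refine List.prefix_of_prefix_length_le (List.prefix_append _ _)
          ((List.prefix_append r _).trans h) ?_
        simp only [List.length_append, List.length_singleton] at hl
        omega
      obtain ⟨t, rfl⟩ := h'
      rw [List.append_assoc, List.prefix_append_right_inj] at h
      exact absurd (h.subset (by simp)) hk3
  have g1 := extreme_pair_mem U₁ I₁ (w := nf y) (by rwa [word_nf]) hch hp hq hmin hmax
  have g5 := extreme_pair_mem U₅ I₅ (w := nf y ++ nf k) (by simpa using hyk)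
    (fun r hr => hch r ((hext r).1 hr)) ((hext p).2 hp) ((hext q).2 hq)
    (fun r hr => hmin r ((hext r).1 hr)) (fun r hr => hmax r ((hext r).1 hr))
  rcases le_total p.length q.length with hl | hl
  · refine step _ g1 g5 ?_
    have := count_three_shorten_lt hp hq hl
    rwa [word_nf, hn] at this
  · refine step _ (inv_mem g1) (inv_mem g5) ?_
    have := count_three_shorten_lt hq hp hl
    rw [word_nf, hn] at this
    simpa [mul_assoc] using this

/-- Three pairwise intersecting cosets of images of `coxThree` under automorphisms preserving
the cyclic order have a common element. -/
theorem helly {α₁ α₃ α₅ : MulAut Cox} (h₁ : α₁ ∈ cycAut) (h₃ : α₃ ∈ cycAut) (h₅ : α₅ ∈ cycAut)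
    {x y z : Cox} (hxy : x⁻¹ * y ∈ α₁ • coxThree) (hyz : y⁻¹ * z ∈ α₃ • coxThree)
    (hxz : x⁻¹ * z ∈ α₅ • coxThree) :
    ∃ w, x⁻¹ * w ∈ α₁ • coxThree ∧ x⁻¹ * w ∈ α₅ • coxThree ∧ w⁻¹ * y ∈ α₃ • coxThree := by
  have m1 := mul_mem (inv_mem h₃) h₁
  have m5 := mul_mem (inv_mem h₃) h₅
  obtain ⟨q, q1, q5, hq⟩ := helly_aux (H₁ := (α₃⁻¹ * α₁) • coxThree)
    (H₅ := (α₃⁻¹ * α₅) • coxThree) (y := α₃⁻¹ (x⁻¹ * y)) (k := α₃⁻¹ (y⁻¹ * z))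
    (unlinked_coxThree.smul m1) (involutionGenerated_coxThree.smul _)
    (unlinked_coxThree.smul m5) (involutionGenerated_coxThree.smul _)
    (by rw [mul_smul]; exact Subgroup.smul_mem_pointwise_smul _ α₃⁻¹ _ hxy)
    (Subgroup.mem_pointwise_smul_iff_inv_smul_mem.1 hyz)
    (by
      rw [← map_mul, mul_smul, show x⁻¹ * y * (y⁻¹ * z) = x⁻¹ * z by group]
      exact Subgroup.smul_mem_pointwise_smul _ α₃⁻¹ _ hxz)
  rw [mul_smul, Subgroup.mem_inv_pointwise_smul_iff] at q1 q5
  refine ⟨x * α₃ q, by simpa using q1, by simpa using q5, ?_⟩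
  rw [Subgroup.mem_pointwise_smul_iff_inv_smul_mem]
  simpa [mul_assoc] using hq

/-! ### The action of the Artin group on `Cox` -/

theorem gen_braid {s : Gen} (hs : s ≠ d) :
    gen s * gen d * gen s = gen d * gen s * gen d := by
  have h := PresentedGroup.one_of_mem (rels := Rels)
    (x := FreeGroup.of s * FreeGroup.of d * FreeGroup.of s *
      (FreeGroup.of d * FreeGroup.of s * FreeGroup.of d)⁻¹)
    ⟨s, d, hs, Or.inl ⟨Or.inr rfl, rfl⟩⟩
  rw [map_mul, map_inv, mul_inv_eq_one] at h
  simp only [map_mul] at h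
  exact h

theorem gen_comm {s t : Gen} (hs : s ≠ d) (ht : t ≠ d) : gen s * gen t = gen t * gen s := by
  by_cases hst : s = t
  · rw [hst]
  have h := PresentedGroup.one_of_mem (rels := Rels)
    (x := FreeGroup.of s * FreeGroup.of t * (FreeGroup.of s)⁻¹ * (FreeGroup.of t)⁻¹)
    ⟨s, t, hst, Or.inr ⟨⟨hs, ht⟩, rfl⟩⟩
  rw [map_mul, map_inv, mul_inv_eq_one, map_mul, map_inv, mul_inv_eq_iff_eq_mul] at h
  simp only [map_mul] at h
  exact h

/-- A homomorphism out of the `D₄` Artin group. -/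
def Artin.lift {G : Type*} [Group G] (f : Gen → G)
    (hb : ∀ s, s ≠ d → f s * f d * f s = f d * f s * f d)
    (hc : ∀ s t, s ≠ d → t ≠ d → f s * f t = f t * f s) : Artin →* G :=
  PresentedGroup.toGroup (f := f) (by
    rintro _ ⟨s, t, hst, ⟨rfl | rfl, rfl⟩ | ⟨⟨hs, ht⟩, rfl⟩⟩
    · rw [map_mul, map_inv, mul_inv_eq_one]
      simpa using (hb t hst.symm).symm
    · simp [hb s hst]
    · simp [hc s t hs ht])

@[simp]
theorem Artin.lift_gen {G : Type*} [Group G] (f : Gen → G)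
    (hb : ∀ s, s ≠ d → f s * f d * f s = f d * f s * f d)
    (hc : ∀ s t, s ≠ d → t ≠ d → f s * f t = f t * f s) (s : Gen) :
    Artin.lift f hb hc (gen s) = f s :=
  PresentedGroup.toGroup.of _

theorem Artin.hom_ext {G : Type*} [Group G] {f g : Artin →* G}
    (h : ∀ s, f (gen s) = g (gen s)) : f = g :=
  PresentedGroup.ext h

theorem Artin.mem_of_gen_mem {S : Subgroup Artin} (h : ∀ s, gen s ∈ S) (g : Artin) : g ∈ S := by
  have : Subgroup.closure (Set.range (PresentedGroup.of (rels := Rels))) ≤ S := by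
    rw [Subgroup.closure_le]
    rintro _ ⟨s, rfl⟩
    exact h s
  rw [PresentedGroup.closure_range_of] at this
  exact this trivial

theorem gen_mem_Ahat {s t : Gen} (h : t ≠ s) : gen t ∈ Ahat s :=
  Subgroup.subset_closure ⟨t, h, rfl⟩

theorem Ahat_le {s : Gen} {S : Subgroup Artin} (h : ∀ t, t ≠ s → gen t ∈ S) : Ahat s ≤ S := by
  rw [Ahat, Subgroup.closure_le]
  rintro _ ⟨t, ht, rfl⟩
  exact h t ht

/-- The transposition of the generators `a` and `b`. -/
def swapGen : Gen → Gen
  | a => b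
  | b => a
  | c => c
  | d => d

theorem swapGen_ne_d {s : Gen} (h : s ≠ d) : swapGen s ≠ d := by
  cases s <;> simp_all [swapGen]

/-- The endomorphism of the Artin group exchanging `a` and `b`. -/
def swapHom : Artin →* Artin :=
  Artin.lift (fun s => gen (swapGen s)) (fun _ hs => gen_braid (swapGen_ne_d hs))
    (fun _ _ hs ht => gen_comm (swapGen_ne_d hs) (swapGen_ne_d ht))

theorem swapHom_gen (s : Gen) : swapHom (gen s) = gen (swapGen s) := Artin.lift_gen ..

theorem swapHom_comp_swapHom : swapHom.comp swapHom = MonoidHom.id _ :=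
  Artin.hom_ext fun s => by
    cases s <;> simp [swapHom_gen, swapGen]

theorem swapHom_swapHom (g : Artin) : swapHom (swapHom g) = g :=
  DFunLike.congr_fun swapHom_comp_swapHom g

theorem swapHom_mem_Ahat {s : Gen} {g : Artin} (h : g ∈ Ahat s) :
    swapHom g ∈ Ahat (swapGen s) := by
  refine (Ahat_le (S := (Ahat (swapGen s)).comap swapHom) fun t ht => ?_) h
  rw [Subgroup.mem_comap, swapHom_gen]
  refine gen_mem_Ahat ?_
  cases s <;> cases t <;> simp_all [swapGen]

theorem mulAut_ext {α β : MulAut Cox} (h : ∀ j, α (refl j) = β (refl j)) : α = β := by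
  have : (α : Cox →* Cox) = β := Cox.hom_ext h
  exact MulEquiv.ext fun x => DFunLike.congr_fun this x

theorem twist_braid {p q r : Fin 4} (hpq : p ≠ q) (hqr : q ≠ r) (hpr : p ≠ r) :
    twist p q hpq * twist q r hqr * twist p q hpq =
      twist q r hqr * twist p q hpq * twist q r hqr := by
  refine mulAut_ext fun j => ?_
  simp only [MulAut.mul_apply, twist_apply]
  by_cases hp : j = p
  · subst hp
    simp [twistHom_left, twistHom_right hpq, twistHom_of_ne hpq hpr,
      twistHom_of_ne hpr.symm hqr.symm, mul_assoc]
  by_cases hq : j = q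
  · subst hq
    simp [twistHom_left, twistHom_right hpq, twistHom_right hqr, twistHom_of_ne hpq hpr,
      twistHom_of_ne hpr.symm hqr.symm, mul_assoc]
  by_cases hr : j = r
  · subst hr
    simp [twistHom_right hpq, twistHom_right hqr, twistHom_of_ne hpq hpr,
      twistHom_of_ne hpr.symm hqr.symm]
  simp [twistHom_of_ne hp hq, twistHom_of_ne hq hr]

theorem twist_comm {p q r s : Fin 4} (hpq : p ≠ q) (hrs : r ≠ s) (hpr : p ≠ r) (hps : p ≠ s)
    (hqr : q ≠ r) (hqs : q ≠ s) :
    twist p q hpq * twist r s hrs = twist r s hrs * twist p q hpq := by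
  refine mulAut_ext fun j => ?_
  simp only [MulAut.mul_apply, twist_apply]
  have h1 : twistHom r s (refl p) = refl p := twistHom_of_ne hpr hps
  have h2 : twistHom r s (refl q) = refl q := twistHom_of_ne hqr hqs
  have h3 : twistHom p q (refl r) = refl r := twistHom_of_ne hpr.symm hqr.symm
  have h4 : twistHom p q (refl s) = refl s := twistHom_of_ne hps.symm hqs.symm
  by_cases hp : j = p
  · subst hp
    simp [twistHom_left, h1, h2]
  by_cases hq : j = q
  · subst hq
    simp [twistHom_right hpq, h1, h2]
  by_cases hr : j = r
  · subst hr
    simp [twistHom_left, h3, h4]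
  by_cases hs : j = s
  · subst hs
    simp [twistHom_right hrs, h3, h4]
  simp [twistHom_of_ne hp hq, twistHom_of_ne hr hs]

/-- The holomorph of `Cox`. -/
abbrev Hol : Type := Cox ⋊[MonoidHom.id (MulAut Cox)] MulAut Cox

/-- The automorphism of `Cox` attached to a generator of the Artin group. -/
def genAut : Gen → MulAut Cox
  | a => twist 0 1 (by decide)
  | b => twist 0 1 (by decide)
  | c => twist 2 3 (by decide)
  | d => twist 1 2 (by decide)

/-- The translation part of the action of a generator of the Artin group on `Cox`. -/
def genTrans : Gen → Cox
  | a => refl 1 * refl 0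
  | _ => 1

theorem genAut_braid {s : Gen} (hs : s ≠ d) :
    genAut s * genAut d * genAut s = genAut d * genAut s * genAut d := by
  cases s
  · exact twist_braid (p := 0) (by decide) (by decide) (by decide)
  · exact twist_braid (p := 0) (by decide) (by decide) (by decide)
  · exact (twist_braid (p := 1) (by decide) (by decide) (by decide)).symm
  · exact absurd rfl hs

theorem genAut_comm {s t : Gen} (hs : s ≠ d) (ht : t ≠ d) :
    genAut s * genAut t = genAut t * genAut s := by
  have h : twist 0 1 (by decide) * twist 2 3 (by decide) =
    twist 2 3 (by decide) * twist 0 1 (by decide) :=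
      twist_comm _ _ (by decide) (by decide) (by decide) (by decide)
  cases s <;> cases t <;> first | rfl | exact h | exact h.symm | exact absurd rfl hs |
    exact absurd rfl ht

/-- The image of a generator of the Artin group in the holomorph of `Cox`. -/
def genHol (s : Gen) : Hol := ⟨genTrans s, genAut s⟩

theorem genAut_apply_refl (s : Gen) (j : Fin 4) : genAut s (refl j) =
    match s, j with
    | a, 0 => refl 0 * refl 1 * refl 0
    | a, 1 => refl 0
    | b, 0 => refl 0 * refl 1 * refl 0
    | b, 1 => refl 0
    | c, 2 => refl 2 * refl 3 * refl 2
    | c, 3 => refl 2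
    | d, 1 => refl 1 * refl 2 * refl 1
    | d, 2 => refl 1
    | _, j => refl j := by
  cases s <;> fin_cases j <;> simp [genAut, twist_apply, twistHom]

theorem genHol_braid {s : Gen} (hs : s ≠ d) :
    genHol s * genHol d * genHol s = genHol d * genHol s * genHol d := by
  refine SemidirectProduct.ext ?_ (genAut_braid hs)
  cases s <;> simp [genHol, genTrans, genAut_apply_refl, mul_assoc] at hs ⊢

theorem genHol_comm {s t : Gen} (hs : s ≠ d) (ht : t ≠ d) :
    genHol s * genHol t = genHol t * genHol s := by
  refine SemidirectProduct.ext ?_ (genAut_comm hs ht)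
  cases s <;> cases t <;> simp [genHol, genTrans, genAut_apply_refl, mul_assoc] at hs ht ⊢

/-- The homomorphism from the Artin group to the holomorph of `Cox`. -/
def toHol : Artin →* Hol :=
  Artin.lift genHol (fun _ => genHol_braid) (fun _ _ => genHol_comm)

/-- The linear part of the action of an element of the Artin group on `Cox`. -/
def linPart (g : Artin) : MulAut Cox := (toHol g).right

/-- The image of `1` under an element of the Artin group. -/
def evalOne (g : Artin) : Cox := (toHol g).left

/-- The image of the first generator of `Cox` under an element of the Artin group. -/
def evalRefl (g : Artin) : Cox := evalOne g * linPart g (refl 0)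

@[simp] theorem linPart_gen (s : Gen) : linPart (gen s) = genAut s := by
  simp [linPart, toHol, genHol]

@[simp] theorem evalOne_gen (s : Gen) : evalOne (gen s) = genTrans s := by
  simp [evalOne, toHol, genHol]

@[simp] theorem linPart_one : linPart 1 = 1 := by simp [linPart]

@[simp] theorem evalOne_one : evalOne 1 = 1 := by simp [evalOne]

theorem linPart_mul (g h : Artin) : linPart (g * h) = linPart g * linPart h := by
  simp [linPart]

theorem linPart_inv (g : Artin) : linPart g⁻¹ = (linPart g)⁻¹ := by
  simp [linPart]

theorem evalOne_mul (g h : Artin) : evalOne (g * h) = evalOne g * linPart g (evalOne h) := by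
  simp [evalOne, linPart]

theorem evalRefl_mul (g h : Artin) :
    evalRefl (g * h) = evalOne g * linPart g (evalRefl h) := by
  simp [evalRefl, evalOne_mul, linPart_mul, mul_assoc]

theorem evalOne_inv (g : Artin) : evalOne g⁻¹ = (linPart g)⁻¹ (evalOne g)⁻¹ := by
  simp [evalOne, linPart]

theorem linPart_mem_cycAut (g : Artin) : linPart g ∈ cycAut := by
  refine Artin.mem_of_gen_mem
    (S := cycAut.comap (SemidirectProduct.rightHom.comp toHol)) (fun s => ?_) g
  change linPart (gen s) ∈ cycAut
  rw [linPart_gen]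
  cases s
  · exact twist_mem_cycAut (p := 0) (by decide) (by decide)
  · exact twist_mem_cycAut (p := 0) (by decide) (by decide)
  · exact twist_mem_cycAut (p := 2) (by decide) (by decide)
  · exact twist_mem_cycAut (p := 1) (by decide) (by decide)

/-- The sign homomorphism of `Cox`. -/
def sign : Cox →* ℤˣ := Cox.lift (fun _ => -1) (fun _ => by simp)

theorem sign_linPart (g : Artin) (x : Cox) : sign (linPart g x) = sign x := by
  have h : ∀ s, sign.comp (genAut s : Cox →* Cox) = sign := fun s => Cox.hom_ext fun j => by
    simp only [MonoidHom.comp_apply, MonoidHom.coe_coe, genAut_apply_refl]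
    split <;> simp [sign]
  refine Artin.mem_of_gen_mem (S :=
    { carrier := { g | ∀ x, sign (linPart g x) = sign x }
      one_mem' := by simp
      mul_mem' := fun {g h} hg hh x => by rw [linPart_mul, MulAut.mul_apply, hg, hh]
      inv_mem' := fun {g} hg x => by rw [← hg, linPart_inv, MulAut.apply_inv_self] })
    (fun s => ?_) g x
  intro x
  rw [linPart_gen]
  exact DFunLike.congr_fun (h s) x

theorem sign_evalOne (g : Artin) : sign (evalOne g) = 1 := by
  refine Artin.mem_of_gen_mem (S :=
    { carrier := { g | sign (evalOne g) = 1 }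
      one_mem' := by simp
      mul_mem' := fun {g h} (hg : _ = _) (hh : _ = _) => by
        change sign (evalOne (g * h)) = 1
        rw [evalOne_mul, map_mul, sign_linPart, hg, hh, one_mul]
      inv_mem' := fun {g} (hg : _ = _) => by
        change sign (evalOne g⁻¹) = 1
        rw [evalOne_inv, ← linPart_inv, sign_linPart, map_inv, hg, inv_one] })
    (fun s => ?_) g
  change sign (evalOne (gen s)) = 1
  cases s <;> simp [genTrans, sign]

theorem sign_evalRefl (g : Artin) : sign (evalRefl g) = -1 := by
  rw [evalRefl, map_mul, sign_linPart, sign_evalOne]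
  simp [sign]

theorem toHol_swapHom (g : Artin) :
    toHol (swapHom g) = SemidirectProduct.inl (refl 0) * toHol g *
      SemidirectProduct.inl (refl 0) := by
  have h0 : (SemidirectProduct.inl (refl 0) : Hol) * SemidirectProduct.inl (refl 0) = 1 := by
    rw [← map_mul, refl_mul_self, map_one]
  have h1 : (SemidirectProduct.inl (refl 0) : Hol)⁻¹ = SemidirectProduct.inl (refl 0) :=
    inv_eq_of_mul_eq_one_left h0
  have key : toHol.comp swapHom =
      (MulAut.conj (SemidirectProduct.inl (refl 0) : Hol) : Hol →* Hol).comp toHol :=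
    Artin.hom_ext fun s => by
      rw [MonoidHom.comp_apply, MonoidHom.comp_apply, MonoidHom.coe_coe, MulAut.conj_apply, h1,
        swapHom_gen]
      simp only [toHol, Artin.lift_gen]
      refine SemidirectProduct.ext ?_ ?_
      · cases s <;> simp [swapGen, genHol, genTrans, genAut_apply_refl, mul_assoc]
      · cases s <;> simp [swapGen, genHol, genAut]
  have := DFunLike.congr_fun key g
  rwa [MonoidHom.comp_apply, MonoidHom.comp_apply, MonoidHom.coe_coe, MulAut.conj_apply, h1]
    at this

theorem evalOne_swapHom (g : Artin) : evalOne (swapHom g) = refl 0 * evalRefl g := by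
  rw [evalOne, toHol_swapHom]
  simp [evalRefl, evalOne, linPart, mul_assoc]

theorem evalRefl_swapHom (g : Artin) : evalRefl (swapHom g) = refl 0 * evalOne g := by
  rw [← swapHom_swapHom g, evalOne_swapHom, swapHom_swapHom, refl_mul_cancel]

/-! ### Reconstruction of the Artin group from its action -/

section Braid

variable {G : Type*} [Group G]

theorem conj_inv_eq_of_braid {x y : G} (h : x * y * x = y * x * y) :
    x * y⁻¹ * x⁻¹ = y⁻¹ * x⁻¹ * y := by
  have h' : x * y = y * x * y * x⁻¹ := eq_mul_inv_of_mul_eq h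
  calc x * y⁻¹ * x⁻¹ = y⁻¹ * x⁻¹ * (x * y) * x * y⁻¹ * x⁻¹ := by group
    _ = y⁻¹ * x⁻¹ * (y * x * y * x⁻¹) * x * y⁻¹ * x⁻¹ := by rw [h']
    _ = y⁻¹ * x⁻¹ * y := by group

theorem conj_eq_of_braid {x y : G} (h : x * y * x = y * x * y) :
    x * y * x⁻¹ = y⁻¹ * x * y := by
  have := congrArg Inv.inv (conj_inv_eq_of_braid h)
  simpa [mul_assoc] using this

/-- If `x, y` satisfy the braid relation and `w` commutes with `y`, then `x` commutes with the
conjugate of `w` by `x * y`. -/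
theorem commute_conj_of_braid {x y w : G} (h : x * y * x = y * x * y) (hw : Commute w y) :
    Commute x (y⁻¹ * (x⁻¹ * w * x) * y) := by
  have h1 := conj_inv_eq_of_braid h
  have h2 := conj_eq_of_braid h
  refine (mul_inv_eq_iff_eq_mul (b := x)).1 ?_
  calc x * (y⁻¹ * (x⁻¹ * w * x) * y) * x⁻¹ = (x * y⁻¹ * x⁻¹) * w * (x * y * x⁻¹) := by group
    _ = y⁻¹ * x⁻¹ * (y * w) * y⁻¹ * x * y := by rw [h1, h2]; group
    _ = y⁻¹ * (x⁻¹ * w * x) * y := by rw [← hw.eq]; group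

/-- The relation `x w x⁻¹ = w (x⁻¹ w x) w` propagates along a braid relation. -/
theorem conj_relation_of_braid {x y w : G} (h : x * y * x = y * x * y) (hw : Commute w y)
    (hx : x * w * x⁻¹ = w * (x⁻¹ * w * x) * w) :
    y * (x⁻¹ * w * x) * y⁻¹ =
      (x⁻¹ * w * x) * (y⁻¹ * (x⁻¹ * w * x) * y) * (x⁻¹ * w * x) := by
  have h1 := conj_inv_eq_of_braid h
  have h2 := conj_eq_of_braid h
  have hw' : y⁻¹ * w * y = w := by rw [mul_assoc, hw.eq, inv_mul_cancel_left]
  have hw2 : y * w * y⁻¹ = w := by rw [← hw.eq, mul_inv_cancel_right]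
  calc y * (x⁻¹ * w * x) * y⁻¹
      = x⁻¹ * ((x * y * x⁻¹) * w * (x * y⁻¹ * x⁻¹)) * x := by group
    _ = x⁻¹ * (y⁻¹ * x * (y * w * y⁻¹) * x⁻¹ * y) * x := by rw [h1, h2]; group
    _ = x⁻¹ * (y⁻¹ * (x * w * x⁻¹) * y) * x := by rw [hw2]; group
    _ = x⁻¹ * ((y⁻¹ * w * y) * (y⁻¹ * x⁻¹ * y) * (y⁻¹ * w * y) * (y⁻¹ * x * y) *
          (y⁻¹ * w * y)) * x := by rw [hx]; group
    _ = x⁻¹ * (w * (x * y⁻¹ * x⁻¹) * w * (x * y * x⁻¹) * w) * x := by rw [hw', h1, h2]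
    _ = (x⁻¹ * w * x) * (y⁻¹ * (x⁻¹ * w * x) * y) * (x⁻¹ * w * x) := by group

end Braid

/-- The automorphism of the Artin group exchanging `a` and `b`. -/
def swapAut : MulAut Artin :=
  MonoidHom.toMulEquiv swapHom swapHom swapHom_comp_swapHom swapHom_comp_swapHom

/-- The holomorph of the Artin group. -/
abbrev ArtinHol : Type := Artin ⋊[MonoidHom.id (MulAut Artin)] MulAut Artin

/-- A generator of the Artin group, in its holomorph. -/
def hgen (s : Gen) : ArtinHol := SemidirectProduct.inl (gen s)

/-- The involution of the holomorph exchanging `a` and `b`. -/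
def hswap : ArtinHol := SemidirectProduct.inr swapAut

theorem hgen_braid {s : Gen} (hs : s ≠ d) :
    hgen s * hgen d * hgen s = hgen d * hgen s * hgen d := by
  simp only [hgen, ← map_mul, gen_braid hs]

theorem hgen_comm {s t : Gen} (hs : s ≠ d) (ht : t ≠ d) : hgen s * hgen t = hgen t * hgen s := by
  simp only [hgen, ← map_mul, gen_comm hs ht]

theorem hswap_mul_self : hswap * hswap = 1 := by
  rw [hswap, ← map_mul, ← map_one SemidirectProduct.inr]
  congr 1
  exact MulEquiv.ext swapHom_swapHom

theorem hswap_mul_hgen (s : Gen) : hswap * hgen s = hgen (swapGen s) * hswap := by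
  rw [hswap, hgen, hgen, ← swapHom_gen]
  ext <;> simp [swapAut]

/-- The involutions of the holomorph of the Artin group which generate a copy of `Cox`. -/
def hinv : Fin 4 → ArtinHol
  | 0 => hswap
  | 1 => (hgen b)⁻¹ * hswap * hgen b
  | 2 => (hgen d)⁻¹ * ((hgen b)⁻¹ * hswap * hgen b) * hgen d
  | 3 => (hgen c)⁻¹ * ((hgen d)⁻¹ * ((hgen b)⁻¹ * hswap * hgen b) * hgen d) * hgen c

theorem conj_mul_self {G : Type*} [Group G] {x w : G} (h : w * w = 1) :
    (x⁻¹ * w * x) * (x⁻¹ * w * x) = 1 := by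
  calc (x⁻¹ * w * x) * (x⁻¹ * w * x) = x⁻¹ * (w * w) * x := by group
    _ = 1 := by rw [h]; group

theorem hinv_mul_self (j : Fin 4) : hinv j * hinv j = 1 := by
  have h1 := conj_mul_self (x := hgen b) hswap_mul_self
  have h2 := conj_mul_self (x := hgen d) h1
  have h3 := conj_mul_self (x := hgen c) h2
  fin_cases j
  exacts [hswap_mul_self, h1, h2, h3]

/-- The homomorphism from `Cox` to the holomorph of the Artin group. -/
def coxToHol : Cox →* ArtinHol := Cox.lift hinv hinv_mul_self

theorem coxToHol_refl (j : Fin 4) : coxToHol (refl j) = hinv j := Cox.lift_refl ..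

theorem hgen_b_conj_hswap :
    hgen b * hswap * (hgen b)⁻¹ = hswap * ((hgen b)⁻¹ * hswap * hgen b) * hswap := by
  have h1 : hswap * hgen b = hgen a * hswap := hswap_mul_hgen b
  have h2 : hgen b * hgen a = hgen a * hgen b := hgen_comm (by decide) (by decide)
  have h3 : hswap⁻¹ = hswap := inv_eq_of_mul_eq_one_left hswap_mul_self
  have h4 : hswap * hgen b * hswap = hgen a := by
    rw [h1, mul_assoc, hswap_mul_self, mul_one]
  have h5 : hswap * (hgen b)⁻¹ * hswap = (hgen a)⁻¹ := by
    rw [← h4, mul_inv_rev, mul_inv_rev, h3, mul_assoc]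
  have h6 : hswap * hgen a = hgen b * hswap := hswap_mul_hgen a
  have h7 : hswap * (hgen b)⁻¹ = (hgen a)⁻¹ * hswap := by
    rw [← h5, mul_assoc, mul_assoc, hswap_mul_self, mul_one]
  calc hgen b * hswap * (hgen b)⁻¹ = hgen b * (hswap * (hgen b)⁻¹) := mul_assoc ..
    _ = hgen b * (hgen a)⁻¹ * hswap := by rw [h7, mul_assoc]
    _ = (hgen a)⁻¹ * (hgen a * hgen b) * (hgen a)⁻¹ * hswap := by group
    _ = (hgen a)⁻¹ * (hgen b * hswap) := by rw [← h2]; group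
    _ = (hgen a)⁻¹ * hswap * hgen a := by rw [← h6]; group
    _ = hswap * (hgen b)⁻¹ * hgen a := by rw [h7]
    _ = hswap * ((hgen b)⁻¹ * hswap * hgen b) * hswap := by
      rw [← h4]
      group

theorem commute_hswap {s : Gen} (hs : swapGen s = s) : Commute hswap (hgen s) := by
  have := hswap_mul_hgen s
  rwa [hs] at this

theorem commute_c_hinv_one : Commute (hinv 1) (hgen c) := by
  have h : Commute (hgen b) (hgen c) := hgen_comm (by decide) (by decide)
  exact (h.inv_left.mul_left (commute_hswap rfl)).mul_left h

theorem conj_eq_of_commute {G : Type*} [Group G] {x w : G} (h : Commute x w) :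
    x * w * x⁻¹ = w := by
  rw [h.eq, mul_inv_cancel_right]

/-- Conjugation by the generators other than `a` on the copy of `Cox` in the holomorph. -/
theorem hgen_conj_coxToHol {s : Gen} (hs : s ≠ a) (x : Cox) :
    hgen s * coxToHol x * (hgen s)⁻¹ = coxToHol (genAut s x) := by
  have hbd : hgen b * hgen d * hgen b = hgen d * hgen b * hgen d := hgen_braid (by decide)
  have hcd : hgen c * hgen d * hgen c = hgen d * hgen c * hgen d := hgen_braid (by decide)
  have Q0 := hgen_b_conj_hswap
  have Q1 := conj_relation_of_braid hbd (commute_hswap rfl) Q0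
  have Q2 := conj_relation_of_braid hcd.symm commute_c_hinv_one Q1
  have key : (MulAut.conj (hgen s) : ArtinHol →* ArtinHol).comp coxToHol =
      coxToHol.comp (genAut s : Cox →* Cox) := Cox.hom_ext fun j => by
    simp only [MonoidHom.comp_apply, MonoidHom.coe_coe, MulAut.conj_apply, genAut_apply_refl,
      coxToHol_refl]
    have C3 : Commute (hgen b) (hinv 2) := commute_conj_of_braid hbd (commute_hswap rfl)
    have C4 : Commute (hgen d) (hinv 3) := commute_conj_of_braid hcd.symm commute_c_hinv_one
    have C5 : Commute (hgen b) (hinv 3) := by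
      have h : Commute (hgen b) (hgen c) := hgen_comm (by decide) (by decide)
      exact (h.inv_right.mul_right C3).mul_right h
    have C6 : Commute (hgen d) (hinv 0) := (commute_hswap rfl).symm
    have C7 : Commute (hgen c) (hinv 0) := (commute_hswap rfl).symm
    have inv_conj : ∀ y w : ArtinHol, y * (y⁻¹ * w * y) * y⁻¹ = w := fun y w => by group
    cases s
    · exact absurd rfl hs
    · fin_cases j
      · simp [coxToHol_refl]
        exact Q0
      · simp [coxToHol_refl]
        exact inv_conj _ _
      · simpa [coxToHol_refl] using conj_eq_of_commute C3
      · simpa [coxToHol_refl] using conj_eq_of_commute C5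
    · fin_cases j
      · simpa [coxToHol_refl] using conj_eq_of_commute C7
      · simpa [coxToHol_refl] using conj_eq_of_commute commute_c_hinv_one.symm
      · simp [coxToHol_refl]
        exact Q2
      · simp [coxToHol_refl]
        exact inv_conj _ _
    · fin_cases j
      · simpa [coxToHol_refl] using conj_eq_of_commute C6
      · simp [coxToHol_refl]
        exact Q1
      · simp [coxToHol_refl]
        exact inv_conj _ _
      · simpa [coxToHol_refl] using conj_eq_of_commute C4
  exact DFunLike.congr_fun key x

theorem hgen_a_eq : hgen a = coxToHol (genTrans a) * hgen b := by
  have h1 : hswap * hgen b = hgen a * hswap := hswap_mul_hgen b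
  have h2 : hgen a * hgen b = hgen b * hgen a := hgen_comm (by decide) (by decide)
  rw [genTrans, map_mul, coxToHol_refl, coxToHol_refl]
  change _ = (hgen b)⁻¹ * hswap * hgen b * hswap * hgen b
  calc hgen a = (hgen b)⁻¹ * (hgen b * hgen a) := by group
    _ = (hgen b)⁻¹ * (hgen a * (hswap * hswap) * hgen b) := by
      rw [← h2, hswap_mul_self, mul_one]
    _ = (hgen b)⁻¹ * ((hgen a * hswap) * hswap * hgen b) := by group
    _ = (hgen b)⁻¹ * hswap * hgen b * hswap * hgen b := by rw [← h1]; group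

/-- The elements of the Artin group which decompose along the copy of `Cox` in the holomorph. -/
def decomposable : Subgroup Artin where
  carrier := { g | ∃ h ∈ Ahat a,
    (SemidirectProduct.inl g : ArtinHol) = coxToHol (evalOne g) * SemidirectProduct.inl h ∧
    ∀ x, SemidirectProduct.inl h * coxToHol x * (SemidirectProduct.inl h)⁻¹ =
      coxToHol (linPart g x) }
  one_mem' := ⟨1, one_mem _, by simp, by simp⟩
  mul_mem' := by
    rintro g g' ⟨h, hh, h1, h2⟩ ⟨h', hh', h1', h2'⟩
    refine ⟨h * h', mul_mem hh hh', ?_, fun x => ?_⟩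
    · rw [map_mul, h1, h1', evalOne_mul, map_mul, ← h2, map_mul]
      group
    · rw [linPart_mul, MulAut.mul_apply, ← h2, ← h2', map_mul]
      group
  inv_mem' := by
    rintro g ⟨h, hh, h1, h2⟩
    have h3 : ∀ x, (SemidirectProduct.inl h⁻¹ : ArtinHol) * coxToHol x *
        (SemidirectProduct.inl h⁻¹)⁻¹ = coxToHol (linPart g⁻¹ x) := fun x => by
      have := h2 (linPart g⁻¹ x)
      rw [linPart_inv, MulAut.apply_inv_self] at this
      rw [linPart_inv, ← this, map_inv]
      group
    refine ⟨h⁻¹, inv_mem hh, ?_, h3⟩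
    rw [evalOne_inv, ← linPart_inv, ← h3, map_inv, h1, map_inv, map_inv]
    group

theorem mem_decomposable (g : Artin) : g ∈ decomposable := by
  refine Artin.mem_of_gen_mem (fun s => ?_) g
  by_cases hs : s = a
  · subst hs
    refine ⟨gen b, gen_mem_Ahat (by decide), ?_, fun x => ?_⟩
    · rw [evalOne_gen]
      exact hgen_a_eq
    · rw [linPart_gen]
      exact hgen_conj_coxToHol (s := b) (by decide) x
  · refine ⟨gen s, gen_mem_Ahat hs, ?_, fun x => ?_⟩
    · have : evalOne (gen s) = 1 := by
        rw [evalOne_gen]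
        cases s <;> first | rfl | exact absurd rfl hs
      rw [this, map_one, one_mul]
    · rw [linPart_gen]
      exact hgen_conj_coxToHol hs x

theorem evalOne_eq_one_iff {g : Artin} : evalOne g = 1 ↔ g ∈ Ahat a := by
  constructor
  · intro hg
    obtain ⟨h, hh, h1, -⟩ := mem_decomposable g
    rw [hg, map_one, one_mul] at h1
    rwa [SemidirectProduct.inl_injective h1]
  · refine fun hg => Ahat_le (S :=
      { carrier := { g | evalOne g = 1 }
        one_mem' := evalOne_one
        mul_mem' := fun {g h} (hg : _ = _) (hh : _ = _) => by
          change evalOne (g * h) = 1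
          rw [evalOne_mul, hg, hh, map_one, one_mul]
        inv_mem' := fun {g} (hg : _ = _) => by
          change evalOne g⁻¹ = 1
          rw [evalOne_inv, hg, inv_one, map_one] }) (fun s hs => ?_) hg
    change evalOne (gen s) = 1
    rw [evalOne_gen]
    cases s <;> first | rfl | exact absurd rfl hs

theorem evalOne_eq_iff {g h : Artin} : evalOne g = evalOne h ↔ g⁻¹ * h ∈ Ahat a := by
  rw [← evalOne_eq_one_iff, evalOne_mul, evalOne_inv, linPart_inv, ← map_mul,
    EmbeddingLike.map_eq_one_iff, inv_mul_eq_one]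

theorem evalRefl_eq_iff {g h : Artin} : evalRefl g = evalRefl h ↔ g⁻¹ * h ∈ Ahat b := by
  rw [← mul_right_inj (refl 0), ← evalOne_swapHom, ← evalOne_swapHom, evalOne_eq_iff, ← map_inv,
    ← map_mul]
  refine ⟨fun hg => ?_, fun hg => ?_⟩
  · rw [← swapHom_swapHom (g⁻¹ * h)]
    have : _ ∈ Ahat (swapGen a) := swapHom_mem_Ahat hg
    exact this
  · have : _ ∈ Ahat (swapGen b) := swapHom_mem_Ahat hg
    exact this

/-! ### Regions of `Cox` attached to the cosets of `A_ĉ` -/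

theorem twistHom_mem_coxThree {p q : Fin 4} (hp : p ≠ 3) (hq : q ≠ 3) {x : Cox}
    (hx : x ∈ coxThree) : twistHom p q x ∈ coxThree := by
  have : coxThree ≤ coxThree.comap (twistHom p q) := by
    rw [coxThree, Subgroup.closure_le, ← coxThree]
    rintro _ ⟨j, hj, rfl⟩
    have h1 := refl_mem_coxThree hp
    have h2 := refl_mem_coxThree hq
    have h3 := refl_mem_coxThree hj
    change twistHom p q (refl j) ∈ coxThree
    simp only [twistHom, Cox.lift_refl]
    split_ifs
    exacts [mul_mem (mul_mem h1 h2) h1, h1, h3]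
  exact this hx

theorem genAut_mem_coxThree {s : Gen} (hs : s ≠ c) (x : Cox) :
    genAut s x ∈ coxThree ↔ x ∈ coxThree := by
  have key : ∀ {p q : Fin 4} (h : p ≠ q), p ≠ 3 → q ≠ 3 →
      (twist p q h x ∈ coxThree ↔ x ∈ coxThree) := fun {p q} h hp hq =>
    ⟨fun hx => by
      have := twistHom_mem_coxThree hq hp hx
      rwa [twist_apply, ← MonoidHom.comp_apply, twistHom_comp_twistHom h.symm] at this,
    fun hx => twistHom_mem_coxThree hp hq hx⟩
  cases s
  · exact key (p := 0) (q := 1) (by decide) (by decide) (by decide)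
  · exact key (p := 0) (q := 1) (by decide) (by decide) (by decide)
  · exact absurd rfl hs
  · exact key (p := 1) (q := 2) (by decide) (by decide) (by decide)

theorem linPart_mem_coxThree {k : Artin} (hk : k ∈ Ahat c) (x : Cox) :
    linPart k x ∈ coxThree ↔ x ∈ coxThree := by
  refine Ahat_le (S :=
    { carrier := { k | ∀ x, linPart k x ∈ coxThree ↔ x ∈ coxThree }
      one_mem' := by simp
      mul_mem' := fun {g h} hg hh x => by rw [linPart_mul, MulAut.mul_apply, hg, hh]
      inv_mem' := fun {g} hg x => by rw [← hg, linPart_inv, MulAut.apply_inv_self] })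
    (fun s hs x => ?_) hk x
  rw [linPart_gen]
  exact genAut_mem_coxThree hs x

theorem evalOne_mem_coxThree {k : Artin} (hk : k ∈ Ahat c) : evalOne k ∈ coxThree := by
  induction hk using Subgroup.closure_induction with
  | one => simp
  | mem x hx =>
    obtain ⟨s, -, rfl⟩ := hx
    rw [evalOne_gen]
    cases s
    · exact mul_mem (refl_mem_coxThree (by decide)) (refl_mem_coxThree (by decide))
    all_goals exact one_mem _
  | mul g h hg _ ihg ihh =>
    rw [evalOne_mul]
    exact mul_mem ihg ((linPart_mem_coxThree hg _).2 ihh)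
  | inv g hg ihg =>
    rw [evalOne_inv, ← linPart_inv]
    exact (linPart_mem_coxThree (inv_mem hg) _).2 (inv_mem ihg)

theorem evalRefl_mem_coxThree {k : Artin} (hk : k ∈ Ahat c) : evalRefl k ∈ coxThree :=
  mul_mem (evalOne_mem_coxThree hk)
    ((linPart_mem_coxThree hk _).2 (refl_mem_coxThree (by decide)))

theorem exists_of_mem_coxThree {x : Cox} (hx : x ∈ coxThree) :
    ∃ k ∈ Ahat c, x = evalOne k ∨ x = evalRefl k := by
  have hrefl : ∀ x, (∃ k ∈ Ahat c, x = evalOne k ∨ x = evalRefl k) →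
      ∃ k ∈ Ahat c, refl 0 * x = evalOne k ∨ refl 0 * x = evalRefl k := by
    rintro x ⟨k, hk, hx⟩
    have hk' : swapHom k ∈ Ahat (swapGen c) := swapHom_mem_Ahat hk
    refine ⟨swapHom k, hk', ?_⟩
    obtain rfl | rfl := hx
    · exact Or.inr (evalRefl_swapHom k).symm
    · exact Or.inl (evalOne_swapHom k).symm
  have hlin : ∀ g ∈ Ahat c, evalOne g = 1 → ∀ x,
      (∃ k ∈ Ahat c, x = evalOne k ∨ x = evalRefl k) →
      ∃ k ∈ Ahat c, linPart g x = evalOne k ∨ linPart g x = evalRefl k := by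
    rintro g hg h1 x ⟨k, hk, rfl | rfl⟩
    · exact ⟨g * k, mul_mem hg hk, Or.inl (by rw [evalOne_mul, h1, one_mul])⟩
    · exact ⟨g * k, mul_mem hg hk, Or.inr (by rw [evalRefl_mul, h1, one_mul])⟩
  have hstep : ∀ s : Gen, s ≠ c → s ≠ a → ∀ j l : Fin 4, genAut s (refl l) = refl j →
      (∀ x, (∃ k ∈ Ahat c, x = evalOne k ∨ x = evalRefl k) →
        ∃ k ∈ Ahat c, refl j * x = evalOne k ∨ refl j * x = evalRefl k) →
      ∀ x, (∃ k ∈ Ahat c, x = evalOne k ∨ x = evalRefl k) →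
        ∃ k ∈ Ahat c, refl l * x = evalOne k ∨ refl l * x = evalRefl k := by
    intro s hs hsa j l hjl hj x hx
    have h1 : gen s ∈ Ahat c := gen_mem_Ahat hs
    have h2 : gen s ∈ Ahat a := gen_mem_Ahat hsa
    have := hlin (gen s)⁻¹ (inv_mem h1) (evalOne_eq_one_iff.2 (inv_mem h2)) _
      (hj _ (hlin (gen s) h1 (evalOne_eq_one_iff.2 h2) x hx))
    rw [linPart_inv, ← hjl, linPart_gen, ← map_mul, MulAut.inv_apply_self] at this
    exact this
  have hrefl1 := hstep b (by decide) (by decide) 0 1 (genAut_apply_refl b 1) hrefl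
  have hrefl2 := hstep d (by decide) (by decide) 1 2 (genAut_apply_refl d 2) hrefl1
  have hall : ∀ j : Fin 4, j ≠ 3 → ∀ x, (∃ k ∈ Ahat c, x = evalOne k ∨ x = evalRefl k) →
      ∃ k ∈ Ahat c, refl j * x = evalOne k ∨ refl j * x = evalRefl k := by
    intro j hj
    fin_cases j
    exacts [hrefl, hrefl1, hrefl2, absurd rfl hj]
  unfold coxThree at hx
  induction hx using Subgroup.closure_induction_left with
  | one => exact ⟨1, one_mem _, Or.inl evalOne_one.symm⟩
  | mul_left y hy z _ ih =>
    obtain ⟨j, hj, rfl⟩ := hy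
    exact hall j hj z ih
  | inv_mul_cancel y hy z _ ih =>
    obtain ⟨j, hj, rfl⟩ := hy
    rw [refl_inv]
    exact hall j hj z ih

/-- The region of `Cox` attached to the coset `h A_ĉ`. -/
def region (h : Artin) : Set Cox := { x | (evalOne h)⁻¹ * x ∈ linPart h • coxThree }

theorem mem_region_iff {h : Artin} {x : Cox} :
    x ∈ region h ↔ ∃ y ∈ coxThree, x = evalOne h * linPart h y := by
  constructor
  · rintro ⟨y, hy, h1⟩
    exact ⟨y, hy, by rw [eq_comm, ← eq_inv_mul_iff_mul_eq]; exact h1⟩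
  · rintro ⟨y, hy, rfl⟩
    exact ⟨y, hy, by simp⟩

theorem evalOne_mem_region {h k : Artin} (hk : h⁻¹ * k ∈ Ahat c) : evalOne k ∈ region h :=
  mem_region_iff.2 ⟨_, evalOne_mem_coxThree hk, by rw [← evalOne_mul, mul_inv_cancel_left]⟩

theorem evalRefl_mem_region {h k : Artin} (hk : h⁻¹ * k ∈ Ahat c) : evalRefl k ∈ region h :=
  mem_region_iff.2 ⟨_, evalRefl_mem_coxThree hk, by rw [← evalRefl_mul, mul_inv_cancel_left]⟩

theorem exists_of_mem_region {h : Artin} {x : Cox} (hx : x ∈ region h) :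
    ∃ k, h⁻¹ * k ∈ Ahat c ∧ (x = evalOne k ∨ x = evalRefl k) := by
  obtain ⟨y, hy, rfl⟩ := mem_region_iff.1 hx
  obtain ⟨k, hk, rfl | rfl⟩ := exists_of_mem_coxThree hy
  · exact ⟨h * k, by simpa using hk, Or.inl (evalOne_mul ..).symm⟩
  · exact ⟨h * k, by simpa using hk, Or.inr (evalRefl_mul ..).symm⟩

theorem inv_mul_mem_of_mem_region {h : Artin} {x y : Cox} (hx : x ∈ region h)
    (hy : y ∈ region h) : x⁻¹ * y ∈ linPart h • coxThree := by
  have hx' : (evalOne h)⁻¹ * x ∈ linPart h • coxThree := hx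
  have hy' : (evalOne h)⁻¹ * y ∈ linPart h • coxThree := hy
  have := mul_mem (inv_mem hx') hy'
  simpa [mul_assoc] using this

theorem mem_region_of_inv_mul_mem {h : Artin} {x y : Cox} (hx : x ∈ region h)
    (hy : x⁻¹ * y ∈ linPart h • coxThree) : y ∈ region h := by
  have hx' : (evalOne h)⁻¹ * x ∈ linPart h • coxThree := hx
  have := mul_mem hx' hy
  simpa [region, mul_assoc] using this

theorem exists_coset_of_mem_regions {h₁ h₃ h₅ : Artin} {w : Cox} (m₁ : w ∈ region h₁)
    (m₃ : w ∈ region h₃) (m₅ : w ∈ region h₅) :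
    ∃ z : Set Artin, (IsCosetOf z (Ahat a) ∨ IsCosetOf z (Ahat b)) ∧
      (z ∩ h₁ • (Ahat c : Set Artin)).Nonempty ∧ (z ∩ h₃ • (Ahat c : Set Artin)).Nonempty ∧
      (z ∩ h₅ • (Ahat c : Set Artin)).Nonempty := by
  have hsign : (1 : ℤˣ) ≠ -1 := by decide
  obtain ⟨k₁, hk₁, e₁⟩ := exists_of_mem_region m₁
  obtain ⟨k₃, hk₃, e₃⟩ := exists_of_mem_region m₃
  obtain ⟨k₅, hk₅, e₅⟩ := exists_of_mem_region m₅
  have mem : ∀ {h k : Artin}, h⁻¹ * k ∈ Ahat c → k ∈ h • (Ahat c : Set Artin) := fun hk =>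
    Set.mem_smul_set_iff_inv_smul_mem.2 hk
  have one : ∀ {k k' : Artin}, w = evalOne k → w = evalRefl k' → False := fun {k k'} e e' =>
    hsign ((sign_evalOne k).symm.trans ((congrArg sign (e.symm.trans e')).trans
      (sign_evalRefl k')))
  have memOne : ∀ {k k' : Artin}, w = evalOne k → w = evalOne k' →
      k' ∈ k • (Ahat a : Set Artin) := fun e e' =>
    Set.mem_smul_set_iff_inv_smul_mem.2 (evalOne_eq_iff.1 (e.symm.trans e'))
  have memRefl : ∀ {k k' : Artin}, w = evalRefl k → w = evalRefl k' →
      k' ∈ k • (Ahat b : Set Artin) := fun e e' =>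
    Set.mem_smul_set_iff_inv_smul_mem.2 (evalRefl_eq_iff.1 (e.symm.trans e'))
  rcases e₁ with e₁ | e₁
  · have e₃' := e₃.resolve_right fun e => one e₁ e
    have e₅' := e₅.resolve_right fun e => one e₁ e
    exact ⟨k₁ • (Ahat a : Set Artin), Or.inl ⟨k₁, rfl⟩, ⟨k₁, memOne e₁ e₁, mem hk₁⟩,
      ⟨k₃, memOne e₁ e₃', mem hk₃⟩, ⟨k₅, memOne e₁ e₅', mem hk₅⟩⟩
  · have e₃' := e₃.resolve_left fun e => one e e₁
    have e₅' := e₅.resolve_left fun e => one e e₁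
    exact ⟨k₁ • (Ahat b : Set Artin), Or.inr ⟨k₁, rfl⟩, ⟨k₁, memRefl e₁ e₁, mem hk₁⟩,
      ⟨k₃, memRefl e₁ e₃', mem hk₃⟩, ⟨k₅, memRefl e₁ e₅', mem hk₅⟩⟩

theorem inv_mul_mem_of_mem_smul {H : Subgroup Artin} {g k k' : Artin}
    (hk : k ∈ g • (H : Set Artin)) (hk' : k' ∈ g • (H : Set Artin)) : k⁻¹ * k' ∈ H := by
  rw [Set.mem_smul_set_iff_inv_smul_mem] at hk hk'
  have := mul_mem (inv_mem (show _ ∈ H from hk)) (show _ ∈ H from hk')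
  simpa [mul_assoc] using this

/-- Every type II 6-cycle satisfies property `(*)`. -/
theorem TypeII.star {x : Fin 6 → Set Artin} (hx : TypeII x) : Star x := by
  obtain ⟨⟨g₀, h0⟩, ⟨g₄, h4⟩, ⟨g₂, h2⟩, ⟨h₁, h1⟩, ⟨h₃, h3⟩, ⟨h₅, h5⟩, -, -, -, -, hi⟩ := hx
  obtain ⟨k01, a01, b01⟩ := hi 0
  obtain ⟨k12, a12, b12⟩ := hi 1
  obtain ⟨k23, a23, b23⟩ := hi 2
  obtain ⟨k34, a34, b34⟩ := hi 3
  obtain ⟨k45, a45, b45⟩ := hi 4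
  obtain ⟨k50, a50, b50⟩ := hi 5
  change k01 ∈ x 1 at b01
  change k12 ∈ x 2 at b12
  change k23 ∈ x 3 at b23
  change k34 ∈ x 4 at b34
  change k45 ∈ x 5 at b45
  change k50 ∈ x 0 at b50
  rw [h0] at a01 b50
  rw [h1] at b01 a12
  rw [h2] at b12 a23
  rw [h3] at b23 a34
  rw [h4] at b34 a45
  rw [h5] at b45 a50
  have mem : ∀ {h k : Artin}, k ∈ h • (Ahat c : Set Artin) → h⁻¹ * k ∈ Ahat c := fun hk =>
    Set.mem_smul_set_iff_inv_smul_mem.1 hk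
  have eX : evalOne k01 = evalOne k50 := evalOne_eq_iff.2 (inv_mul_mem_of_mem_smul a01 b50)
  have eY : evalRefl k12 = evalRefl k23 := evalRefl_eq_iff.2 (inv_mul_mem_of_mem_smul b12 a23)
  have eZ : evalOne k34 = evalOne k45 := evalOne_eq_iff.2 (inv_mul_mem_of_mem_smul b34 a45)
  have mX1 := evalOne_mem_region (mem b01)
  have mX5 := evalOne_mem_region (mem a50)
  have mY1 := evalRefl_mem_region (mem a12)
  have mY3 := evalRefl_mem_region (mem b23)
  have mZ3 := evalOne_mem_region (mem a34)
  have mZ5 := evalOne_mem_region (mem b45)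
  rw [← eX] at mX5
  rw [← eY] at mY3
  rw [← eZ] at mZ5
  obtain ⟨w, w1, w5, w3⟩ := helly (linPart_mem_cycAut h₁) (linPart_mem_cycAut h₃)
    (linPart_mem_cycAut h₅) (inv_mul_mem_of_mem_region mX1 mY1)
    (inv_mul_mem_of_mem_region mY3 mZ3) (inv_mul_mem_of_mem_region mX5 mZ5)
  unfold Star
  rw [h1, h3, h5]
  refine exists_coset_of_mem_regions (mem_region_of_inv_mul_mem mX1 w1)
    (mem_region_of_inv_mul_mem mY3 ?_) (mem_region_of_inv_mul_mem mX5 w5)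
  simpa using inv_mem w3

end D4Artin

/-- For every type II 6-cycle `(x 0, …, x 5)` in the `D₄` Artin complex with `x 0` and `x 3`
not adjacent, either `x 1` and `x 5` are adjacent to a common vertex of type `b̂`, or the
cycle satisfies property `(*)`. -/
theorem typeII_nonadjacent_alternative (x : Fin 6 → Set Artin) (hx : TypeII x)
    (h03 : x 0 ∩ x 3 = ∅) :
    (∃ z : Set Artin, IsCosetOf z (Ahat b) ∧ (z ∩ x 1).Nonempty ∧ (z ∩ x 5).Nonempty) ∨
      Star x := by
  exact Or.inr hx.star
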